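/- arXiv:1811.08733 — 3 statements merged into one kernel-verified Lean document; each statement's English description precedes it below -/
import Mathlib

section
/- The operators φ̂_j (j ∈ ℤ) on B = ℂ[t_1,t_3,t_5,…] defined by the vertex operator generating series satisfy the anticommutation relations of the type-B Clifford algebra: φ̂_i φ̂_j + φ̂_j φ̂_i = (−1)^i δ_{i,−j} · id_B for all i, j ∈ ℤ. In particular φ̂_0^2 = (1/2) id_B. -/
/- ## Setup: the ring `B = ℂ[t₁,t₃,t₅,…]`, elementary Schur polynomials,
   vertex-operator coefficients, and the BKP bilinear identity. -/

noncomputable section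

open MvPolynomial

/-- The polynomial ring `B = ℂ[t₁,t₃,t₅,…]`; variable `i` represents `t_{2i+1}`. -/
abbrev BRing : Type := MvPolynomial ℕ ℂ

/-- The universal elementary Schur polynomials `s_n`, defined by
`exp (∑_{j≥1} t_j z^j) = ∑_{n≥0} s_n(t) z^n`; here the variable `j` (for `j ≥ 1`)
represents `t_j`.  They satisfy `s_0 = 1` and `(n+1) s_{n+1} = ∑_{j=1}^{n+1} j t_j s_{n+1-j}`. -/
def schurPoly : ℕ → MvPolynomial ℕ ℂ
  | 0 => 1
  | n + 1 =>
      ((n + 1 : ℂ))⁻¹ •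
        ∑ j ∈ Finset.range (n + 1),
          ((j + 1 : ℂ)) • (MvPolynomial.X (j + 1) * schurPoly (n - j))
  termination_by n => n
  decreasing_by omega

/-- `s_n(c)` for a complex sequence `c = (c_1, c_2, …)` (the entry `c 0` is ignored). -/
def sC (n : ℕ) (c : ℕ → ℂ) : ℂ := MvPolynomial.eval c (schurPoly n)

/-- `s_n` evaluated on a sequence of elements of `B`. -/
def sB (n : ℕ) (c : ℕ → BRing) : BRing := MvPolynomial.aeval c (schurPoly n)

/-- The sequence `t̃ = (t₁, 0, t₃, 0, t₅, 0, …)` of elements of `B`. -/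
def tTilde : ℕ → BRing := fun j => if j % 2 = 1 then MvPolynomial.X ((j - 1) / 2) else 0

/-- The sequence `t̃ + c` for a constant sequence `c`. -/
def tShift (c : ℕ → ℂ) : ℕ → BRing := fun j => tTilde j + MvPolynomial.C (c j)

/-- `s̃_m = s_m(t̃) ∈ B` for `m ≥ 0`, and `0` for `m < 0`; these are the coefficients of
`exp (∑_{j>0 odd} t_j z^j)`. -/
def sTildeZ (m : ℤ) : BRing :=
  if 0 ≤ m then MvPolynomial.aeval tTilde (schurPoly m.toNat) else 0

/-- `s_m(-t̃) ∈ B` for `m ≥ 0`, and `0` for `m < 0`; the coefficients of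
`exp (-∑_{j>0 odd} t_j z^j)`. -/
def sTildeNegZ (m : ℤ) : BRing :=
  if 0 ≤ m then MvPolynomial.aeval (fun j => -(tTilde j)) (schurPoly m.toNat) else 0

/-- `p(t₁ - 2w, t₃ - (2/3)w³, t₅ - (2/5)w⁵, …)` as a polynomial in `w` (which stands for
`z⁻¹`) over `B`: this is `exp (-2∑_{j>0 odd} (1/j) ∂/∂t_j z^{-j}) p` by Taylor's formula. -/
def shiftMinus (p : BRing) : Polynomial BRing :=
  MvPolynomial.aeval
    (fun i => Polynomial.C (MvPolynomial.X i) -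
      Polynomial.C (MvPolynomial.C ((2 : ℂ) / ((2 * i + 1 : ℕ) : ℂ))) *
        Polynomial.X ^ (2 * i + 1)) p

/-- `p(t₁ + 2w, t₃ + (2/3)w³, …)`, i.e. `exp (2∑_{j>0 odd} (1/j) ∂/∂t_j z^{-j}) p`. -/
def shiftPlus (p : BRing) : Polynomial BRing :=
  MvPolynomial.aeval
    (fun i => Polynomial.C (MvPolynomial.X i) +
      Polynomial.C (MvPolynomial.C ((2 : ℂ) / ((2 * i + 1 : ℕ) : ℂ))) *
        Polynomial.X ^ (2 * i + 1)) p

/-- The coefficient of `z^m` in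
`exp (∑_{j>0 odd} t_j z^j) exp (-2∑_{j>0 odd} (1/j)(∂/∂t_j) z^{-j}) τ`. -/
def leftCoeff (τ : BRing) (m : ℤ) : BRing :=
  ∑ᶠ k : ℕ, sTildeZ (m + k) * (shiftMinus τ).coeff k

/-- The coefficient of `z^m` in
`exp (-∑_{j>0 odd} t_j z^j) exp (2∑_{j>0 odd} (1/j)(∂/∂t_j) z^{-j}) τ`. -/
def rightCoeff (τ : BRing) (m : ℤ) : BRing :=
  ∑ᶠ k : ℕ, sTildeNegZ (m + k) * (shiftPlus τ).coeff k

/-- `ℂ[t₁,t₃,…] ⊗ ℂ[t'₁,t'₃,…]`, realized as polynomials in two families of variables. -/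
abbrev BRing2 : Type := MvPolynomial (ℕ ⊕ ℕ) ℂ

/-- The embedding `p(t) ↦ p(t) ∈ ℂ[t] ⊗ ℂ[t']` on the first factor. -/
def inL : BRing →+* BRing2 := (MvPolynomial.rename Sum.inl).toRingHom

/-- The embedding `p(t') ↦ p(t') ∈ ℂ[t] ⊗ ℂ[t']` on the second factor. -/
def inR : BRing →+* BRing2 := (MvPolynomial.rename Sum.inr).toRingHom

/-- The BKP bilinear identity on `τ ∈ ℂ[t₁,t₃,t₅,…]`: the coefficient of `z⁰` in
`(exp(∑ t_j z^j) exp(-2∑ (1/j)∂_{t_j} z^{-j}) τ)(t) ·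
 (exp(-∑ t'_j z^j) exp(2∑ (1/j)∂_{t'_j} z^{-j}) τ)(t')`
equals `τ(t) τ(t')` (all sums over odd `j > 0`; only finitely many summands below
are nonzero since `τ` is a polynomial). -/
def SatisfiesBKP (τ : BRing) : Prop :=
  ∑ᶠ m : ℤ, inL (leftCoeff τ m) * inR (rightCoeff τ (-m)) = inL τ * inR τ

/-- The MDKP bilinear identity on a pair `(τ₀, τ₁)`. -/
def SatisfiesMDKP (τ₀ τ₁ : BRing) : Prop :=
  ∑ᶠ m : ℤ, inL (leftCoeff τ₀ m) * inR (rightCoeff τ₁ (-m)) = inL τ₁ * inR τ₀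

/-- The condition on a permutation `σ` appearing in the definition of the Pfaffian:
`σ(2i-1) < σ(2i)` for all `i`, and `σ(1) < σ(3) < ⋯` (with 0-based indices here). -/
def pfaffianCond {m : ℕ} (σ : Equiv.Perm (Fin m)) : Prop :=
  (∀ i : Fin (m / 2),
      σ ⟨2 * i.val, by have := i.isLt; omega⟩ < σ ⟨2 * i.val + 1, by have := i.isLt; omega⟩) ∧
  (∀ i j : Fin (m / 2), i < j →
      σ ⟨2 * i.val, by have := i.isLt; omega⟩ < σ ⟨2 * j.val, by have := j.isLt; omega⟩)

open scoped Classical in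
/-- The Pfaffian `Pf(A) = ∑_σ sgn(σ) ∏_i a_{σ(2i-1),σ(2i)}` of a (skew-symmetric) matrix;
it is intended to be used for matrices of even size `m = 2n`. -/
def pfaffian {R : Type*} [CommRing R] {m : ℕ} (A : Matrix (Fin m) (Fin m) R) : R :=
  ∑ σ : Equiv.Perm (Fin m),
    if pfaffianCond σ then
      (Equiv.Perm.sign σ : ℤ) •
        ∏ i : Fin (m / 2),
          A (σ ⟨2 * i.val, by have := i.isLt; omega⟩)
            (σ ⟨2 * i.val + 1, by have := i.isLt; omega⟩)
    else 0

/-- The skew-symmetric matrix with `(i,j)`-entry `f i j` for `i < j`. -/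
def skewOf {R : Type*} [CommRing R] {m : ℕ} (f : Fin m → Fin m → R) :
    Matrix (Fin m) (Fin m) R :=
  Matrix.of fun i j => if i < j then f i j else if j < i then -f j i else 0

/-- `χ_{λ,μ}(c,c') = (1/2) s_λ(c) s_μ(c') + ∑_{ℓ=1}^{μ} (-1)^ℓ s_{λ+ℓ}(c) s_{μ-ℓ}(c')`,
for `λ > μ ≥ 0` and sequences `c, c'` of elements of `B`. -/
def chiB (l μ : ℕ) (c c' : ℕ → BRing) : BRing :=
  (2 : ℂ)⁻¹ • (sB l c * sB μ c') +
    ∑ ℓ ∈ Finset.Icc 1 μ, ((-1 : ℂ) ^ ℓ) • (sB (l + ℓ) c * sB (μ - ℓ) c')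

/-- The skew-symmetric matrix `( χ_{λ_i,λ_j}(t̃+c_i, t̃+c_j) )_{i,j}`. -/
def chiMatrix {m : ℕ} (lam : Fin m → ℕ) (c : Fin m → ℕ → ℂ) :
    Matrix (Fin m) (Fin m) BRing :=
  skewOf fun i j => chiB (lam i) (lam j) (tShift (c i)) (tShift (c j))

/-- `√2` as a complex number. -/
def sqrt2 : ℂ := (Real.sqrt 2 : ℂ)

/-- `ρ_{λ,μ}(c,c';b,b') = (s_λ(c)/√2 - b)(s_μ(c')/√2 + b')
  + ∑_{ℓ=1}^{μ} (-1)^ℓ s_{λ+ℓ}(c) s_{μ-ℓ}(c')` for `λ > μ ≥ 0`. -/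
def rhoB (l μ : ℕ) (c c' : ℕ → BRing) (b b' : ℂ) : BRing :=
  (sqrt2⁻¹ • sB l c - MvPolynomial.C b) * (sqrt2⁻¹ • sB μ c' + MvPolynomial.C b') +
    ∑ ℓ ∈ Finset.Icc 1 μ, ((-1 : ℂ) ^ ℓ) • (sB (l + ℓ) c * sB (μ - ℓ) c')

/-- `ρ_λ(c;b) = s_λ(c)/√2 + b`. -/
def rho1B (l : ℕ) (c : ℕ → BRing) (b : ℂ) : BRing :=
  sqrt2⁻¹ • sB l c + MvPolynomial.C b

/-- The `2n × 2n` skew-symmetric matrix `( ρ_{λ_i,λ_j}(t̃+c_i, t̃+c_j; b_i, b_j) )_{i,j}`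
(for an even number `m = 2n` of rows of `λ`). -/
def rhoMatrixEven {m : ℕ} (lam : Fin m → ℕ) (c : Fin m → ℕ → ℂ) (b : Fin m → ℂ) :
    Matrix (Fin m) (Fin m) BRing :=
  skewOf fun i j => rhoB (lam i) (lam j) (tShift (c i)) (tShift (c j)) (b i) (b j)

/-- For an odd number `m` of parts `λ_1 > ⋯ > λ_m ≥ 0`, the `(m+1) × (m+1)`
skew-symmetric matrix with rows/columns indexed by `0, 1, …, m`, whose `(0,j)`-entry is
`ρ_{λ_j}(t̃+c_j; b_j)` and whose `(i,j)`-entry for `1 ≤ i < j` is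
`ρ_{λ_i,λ_j}(t̃+c_i, t̃+c_j; b_i, b_j)`. -/
def rhoMatrixOdd {m : ℕ} (lam : Fin m → ℕ) (c : Fin m → ℕ → ℂ) (b : Fin m → ℂ) :
    Matrix (Fin (m + 1)) (Fin (m + 1)) BRing :=
  skewOf fun i j =>
    if i.val = 0 then
      if hj : j.val = 0 then 0
      else
        rho1B (lam ⟨j.val - 1, by have := j.isLt; omega⟩)
          (tShift (c ⟨j.val - 1, by have := j.isLt; omega⟩))
          (b ⟨j.val - 1, by have := j.isLt; omega⟩)
    else
      if hj : j.val = 0 then 0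
      else
        rhoB (lam ⟨i.val - 1, by have := i.isLt; omega⟩)
          (lam ⟨j.val - 1, by have := j.isLt; omega⟩)
          (tShift (c ⟨i.val - 1, by have := i.isLt; omega⟩))
          (tShift (c ⟨j.val - 1, by have := j.isLt; omega⟩))
          (b ⟨i.val - 1, by have := i.isLt; omega⟩)
          (b ⟨j.val - 1, by have := j.isLt; omega⟩)

/-- The DKP tau-function `ρ_λ(t̃; c_1,…,c_k; b_1,…,b_k)` attached to an extended strict
partition `λ` with `k` parts: a Pfaffian of size `k` if `k` is even, and of size `k+1`
(with an extra 0-th row built from the `ρ_{λ_j}`) if `k` is odd. -/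
def rhoTau {k : ℕ} (lam : Fin k → ℕ) (c : Fin k → ℕ → ℂ) (b : Fin k → ℂ) : BRing :=
  if k % 2 = 0 then pfaffian (rhoMatrixEven lam c b)
  else pfaffian (rhoMatrixOdd lam c b)

/-- The operators `φ̂_j` (`j ∈ ℤ`) on `B`, defined by the generating series
`∑_{j∈ℤ} φ̂_j z^{-j} = (1/√2) exp(∑_{k>0 odd} t_k z^k) exp(-∑_{k>0 odd} (2/k) ∂_{t_k} z^{-k})`. -/
def phiHat (j : ℤ) (p : BRing) : BRing :=
  sqrt2⁻¹ • ∑ᶠ k : ℕ, sTildeZ ((k : ℤ) - j) * (shiftMinus p).coeff k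

/-- `a : ℤ → ℂ` vanishes for all sufficiently negative indices. -/
def BddBelowSupport (a : ℤ → ℂ) : Prop := ∃ N : ℤ, ∀ j < N, a j = 0

/-- The operator `v = ∑_{j∈ℤ} a_j φ̂_j` on `B` (a finite sum on each polynomial,
when `a` has support bounded below). -/
def vOp (a : ℤ → ℂ) (p : BRing) : BRing := ∑ᶠ j : ℤ, a j • phiHat j p

/-- Evaluation at `t = 0`, `ev₀ : B → ℂ` (the vacuum expectation value). -/
def ev0 : BRing → ℂ := MvPolynomial.eval (fun _ => 0)

/-- The "`√2` times `φ̂_j`" vertex operator coefficients (without the `1/√2` factor),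
used for the type `D` construction. -/
def vertexB (j : ℤ) (p : BRing) : BRing :=
  ∑ᶠ k : ℕ, sTildeZ ((k : ℤ) - j) * (shiftMinus p).coeff k

/-- `B_D = ℂ[θ] ⊗ B` with `θ` a Grassmann variable: the pair `(p₀, p₁)` represents
`p₀ + θ p₁`. -/
abbrev BD : Type := BRing × BRing

/-- The operators `Φ̂_j` (`j ∈ ℤ`) on `B_D`, defined by
`∑_j Φ̂_j z^{-j} = (1/√2)(θ + ∂/∂θ) exp(∑ t_k z^k) exp(-∑ (2/k) ∂_{t_k} z^{-k})`. -/
def PhiHatD (j : ℤ) (p : BD) : BD :=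
  sqrt2⁻¹ • (vertexB j p.2, vertexB j p.1)

/-- `Ψ = (θ - ∂/∂θ)/√2` on `B_D`. -/
def PsiD (p : BD) : BD := sqrt2⁻¹ • (-p.2, p.1)

/-- The type `D` fermions `φ̂_a`, `a ∈ ½ + ℤ`, where the integer `m` encodes the
half-integer index `a = m + ½`:  `φ̂_{-i-½} = Φ̂_{-i}` and `φ̂_{i+½} = (-1)^i Φ̂_i`
for `i ≥ 1`, `φ̂_{-½} = (Φ̂_0 + Ψ)/√2`, `φ̂_{½} = (Φ̂_0 - Ψ)/√2`. -/
def phiD (m : ℤ) (p : BD) : BD :=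
  if m ≤ -2 then PhiHatD (m + 1) p
  else if m = -1 then sqrt2⁻¹ • (PhiHatD 0 p + PsiD p)
  else if m = 0 then sqrt2⁻¹ • (PhiHatD 0 p - PsiD p)
  else ((-1 : ℂ) ^ m) • PhiHatD m p

end

noncomputable section

namespace PhiAux

open PowerSeries in
theorem derivative_mk' {R : Type*} [CommRing R] (f : ℕ → R) :
    PowerSeries.derivative (R := R) (PowerSeries.mk f) = PowerSeries.mk (fun n => f (n+1) * (n+1)) := by
  ext n; simp [PowerSeries.coeff_derivative]

/-- nat-indexed -/
def S (n : ℕ) : BRing := MvPolynomial.aeval tTilde (schurPoly n)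

theorem S_zero : S 0 = 1 := by simp [S, schurPoly]

theorem S_succ (n : ℕ) : S (n+1) * ((n:BRing)+1) =
    ∑ j ∈ Finset.range (n+1), ((j:BRing)+1) * tTilde (j+1) * S (n-j) := by
  have h : (n:ℂ)+1 ≠ 0 := by exact_mod_cast Nat.succ_ne_zero n
  have e : ((n:BRing)+1) = MvPolynomial.C ((n:ℂ)+1) := by simp
  rw [S, schurPoly, map_smul, e, mul_comm, ← MvPolynomial.smul_eq_C_mul, smul_smul,
    mul_inv_cancel₀ h, one_smul, map_sum]
  refine Finset.sum_congr rfl fun j _ => ?_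
  rw [map_smul, map_mul, MvPolynomial.aeval_X, MvPolynomial.smul_eq_C_mul, S]
  simp [mul_assoc]

def SS : PowerSeries BRing := PowerSeries.mk S
def SN : PowerSeries BRing := PowerSeries.mk (fun n => (-1)^n * S n)
def TT : PowerSeries BRing := PowerSeries.mk (fun j => ((j:BRing)+1) * tTilde (j+1))

theorem dSS : PowerSeries.derivative (R := BRing) SS = TT * SS := by
  rw [SS, derivative_mk']
  ext1 n
  rw [PowerSeries.coeff_mul, Finset.Nat.sum_antidiagonal_eq_sum_range_succ_mk]
  simp [TT, S_succ]

theorem dSN : PowerSeries.derivative (R := BRing) SN = - (TT * SN) := by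
  rw [SN, derivative_mk']
  ext1 n
  rw [map_neg, PowerSeries.coeff_mul, Finset.Nat.sum_antidiagonal_eq_sum_range_succ_mk]
  simp only [TT, PowerSeries.coeff_mk]
  rw [mul_assoc, S_succ, Finset.mul_sum, ← Finset.sum_neg_distrib]
  refine Finset.sum_congr rfl fun j hj => ?_
  have hj' : j ≤ n := by simpa [Nat.lt_succ_iff] using hj
  rcases Nat.even_or_odd j with h | h
  · have : (-1:BRing)^(n+1) = - (-1)^(n-j) := by
      obtain ⟨m, rfl⟩ := Nat.exists_eq_add_of_le hj'
      rw [Nat.add_sub_cancel_left, pow_succ, pow_add, h.neg_one_pow]; ring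
    rw [this]; ring
  · have : tTilde (j+1) = 0 := by
      have := h.add_one
      rw [tTilde, if_neg]; rw [Nat.even_iff] at this; omega
    simp [this]

theorem SS_mul_SN : SS * SN = 1 := by
  apply PowerSeries.derivative.ext
  · rw [Derivation.leibniz, dSS, dSN]
    simp only [smul_eq_mul, Derivation.map_one_eq_zero]; ring
  · simp [SS, SN, S_zero]

theorem conv (n : ℕ) : ∑ m ∈ Finset.range (n+1), (-1)^m * (S m * S (n-m)) = if n = 0 then 1 else 0 := by
  have h := congrArg (PowerSeries.coeff n) SS_mul_SN
  rw [mul_comm, PowerSeries.coeff_mul, Finset.Nat.sum_antidiagonal_eq_sum_range_succ_mk,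
    PowerSeries.coeff_one] at h
  rw [← h]
  simp [SS, SN, mul_assoc]

/-- shift as algebra hom -/
def sh : BRing →ₐ[ℂ] Polynomial BRing := MvPolynomial.aeval
    (fun i => Polynomial.C (MvPolynomial.X i) -
      Polynomial.C (MvPolynomial.C ((2 : ℂ) / ((2 * i + 1 : ℕ) : ℂ))) *
        Polynomial.X ^ (2 * i + 1))

theorem shiftMinus_eq (p : BRing) : shiftMinus p = sh p := rfl

theorem derivative_map {A B : Type*} [CommRing A] [CommRing B] (f : A →+* B) (p : PowerSeries A) :
    PowerSeries.derivative (R := B) (PowerSeries.map f p) =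
      PowerSeries.map f (PowerSeries.derivative (R := A) p) := by
  ext n; simp [PowerSeries.coeff_derivative]

abbrev PP := PowerSeries (Polynomial BRing)

def W : PP := PowerSeries.C (Polynomial.X)
def WZ : PP := PowerSeries.C (Polynomial.X) * PowerSeries.X
def gS {R : Type*} [CommRing R] (a : R) : PowerSeries R := PowerSeries.mk (fun n => a^n)
def gN {R : Type*} [CommRing R] (a : R) : PowerSeries R := PowerSeries.mk (fun n => (-a)^n)

theorem geom {R : Type*} [CommRing R] (a : R) :
    gS a * (1 - PowerSeries.C a * PowerSeries.X) = 1 := by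
  ext n
  cases n with
  | zero => simp [gS, mul_sub]
  | succ n =>
    rw [mul_sub, mul_one, map_sub, mul_left_comm, PowerSeries.coeff_C_mul,
      PowerSeries.coeff_succ_mul_X]
    simp [gS, PowerSeries.coeff_one, pow_succ']

theorem geomN {R : Type*} [CommRing R] (a : R) :
    gN a * (1 + PowerSeries.C a * PowerSeries.X) = 1 := by
  have := geom (-a)
  rw [map_neg, neg_mul, sub_neg_eq_add] at this
  exact this

theorem gSN_even {R : Type*} [CommRing R] (a : R) (n : ℕ) (h : Even n) :
    PowerSeries.coeff n (gS a + gN a) = 2 * a^n := by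
  rw [map_add, gS, gN, PowerSeries.coeff_mk, PowerSeries.coeff_mk, h.neg_pow]; ring

theorem gSN_odd {R : Type*} [CommRing R] (a : R) (n : ℕ) (h : Odd n) :
    PowerSeries.coeff n (gS a + gN a) = 0 := by
  rw [map_add, gS, gN, PowerSeries.coeff_mk, PowerSeries.coeff_mk, h.neg_pow]; ring

theorem dgWZ {R : Type*} [CommRing R] (a : R) :
    PowerSeries.derivative (R := R) (PowerSeries.C a * PowerSeries.X) = PowerSeries.C a := by
  ext1 n
  rw [PowerSeries.coeff_derivative, PowerSeries.coeff_succ_mul_X, PowerSeries.coeff_C]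
  split_ifs with h <;> simp [h]

theorem dgS {R : Type*} [CommRing R] (a : R) :
    PowerSeries.derivative (R := R) (gS a) = PowerSeries.C a * gS a ^2 := by
  have h := congrArg (PowerSeries.derivative (R := R)) (geom a)
  rw [Derivation.leibniz, map_sub, dgWZ, Derivation.map_one_eq_zero] at h
  simp only [smul_eq_mul] at h
  linear_combination gS a * h - (PowerSeries.derivative (R := R) (gS a)) * geom a

def II : PP := gS Polynomial.X
def JJ : PP := gN Polynomial.X
theorem II_mul : II * (1 - WZ) = 1 := geom _
theorem JJ_mul : JJ * (1 + WZ) = 1 := geomN _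
theorem dWZ : PowerSeries.derivative (R := Polynomial BRing) WZ = W := dgWZ _
theorem dII : PowerSeries.derivative (R := Polynomial BRing) II = W * II^2 := dgS _

theorem shTT : PowerSeries.map (sh : BRing →+* Polynomial BRing) TT =
    PowerSeries.map (Polynomial.C : BRing →+* Polynomial BRing) TT - 2 * W * (II * JJ) := by
  have key : 2 * (II * JJ) = II + JJ := by
    linear_combination JJ * II_mul + II * JJ_mul
  have e : 2 * W * (II * JJ) = W * (II + JJ) := by rw [← key]; ring
  rw [e]
  ext1 n
  rw [map_sub, W, PowerSeries.coeff_C_mul]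
  simp only [PowerSeries.coeff_map, TT, PowerSeries.coeff_mk, II, JJ, tTilde]
  rcases Nat.even_or_odd n with h | h
  · obtain ⟨m, rfl⟩ := h
    rw [if_pos (by omega), show (m+m+1-1)/2 = m by omega, gSN_even _ _ ⟨m, rfl⟩]
    have hs : sh (MvPolynomial.X m) = Polynomial.C (MvPolynomial.X m) -
      Polynomial.C (MvPolynomial.C ((2 : ℂ) / ((2 * m + 1 : ℕ) : ℂ))) *
        Polynomial.X ^ (2 * m + 1) := by simp [sh]
    have hc : (((m+m:ℕ):Polynomial BRing)+1) * Polynomial.C (MvPolynomial.C ((2 : ℂ) / ((2 * m + 1 : ℕ) : ℂ))) = 2 := by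
      have : (((m+m:ℕ):Polynomial BRing)+1) = Polynomial.C (MvPolynomial.C (((2*m+1:ℕ):ℂ))) := by
        rw [map_natCast, map_natCast]; push_cast; ring
      rw [this, ← Polynomial.C_mul, ← MvPolynomial.C_mul, mul_div_cancel₀]
      · exact map_ofNat ((Polynomial.C : BRing →+* Polynomial BRing).comp MvPolynomial.C) 2
      · exact Nat.cast_ne_zero.mpr (Nat.succ_ne_zero (2*m))
    simp only [RingHom.coe_coe, map_mul, hs, map_add, map_natCast, map_one]
    linear_combination (-Polynomial.X ^ (2 * m + 1)) * hc
  · rw [if_neg (by rw [Nat.odd_iff] at h; omega), gSN_odd _ _ h]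
    simp

theorem shSS : PowerSeries.map (sh : BRing →+* Polynomial BRing) SS * (1 + WZ) =
    PowerSeries.map (Polynomial.C : BRing →+* Polynomial BRing) SS * (1 - WZ) := by
  set P := PowerSeries.map (sh : BRing →+* Polynomial BRing) SS with hP
  set Q := PowerSeries.map (Polynomial.C : BRing →+* Polynomial BRing) SS with hQ
  set N := PowerSeries.map (Polynomial.C : BRing →+* Polynomial BRing) SN with hN
  have hQN : Q * N = 1 := by rw [hQ, hN, ← map_mul, SS_mul_SN, map_one]
  have hdP := derivative_map (sh : BRing →+* Polynomial BRing) SS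
  have hdN := derivative_map (Polynomial.C : BRing →+* Polynomial BRing) SN
  rw [dSS, map_mul, shTT, ← hP] at hdP
  rw [dSN, map_neg, map_mul, ← hN] at hdN
  have hK : P * N * ((1 + WZ) * II) = 1 := by
    apply PowerSeries.derivative.ext
    · simp only [Derivation.leibniz, smul_eq_mul, map_add, dWZ, dII, Derivation.map_one_eq_zero,
        hdP, hdN]
      linear_combination (-2 * W * II^2 * P * N) * JJ_mul - W * II * P * N * II_mul
    · have e1 : PowerSeries.constantCoeff P = 1 := by
        rw [← PowerSeries.coeff_zero_eq_constantCoeff_apply, hP, PowerSeries.coeff_map, SS,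
          PowerSeries.coeff_mk, S_zero, map_one]
      have e2 : PowerSeries.constantCoeff N = 1 := by
        rw [← PowerSeries.coeff_zero_eq_constantCoeff_apply, hN, PowerSeries.coeff_map, SN,
          PowerSeries.coeff_mk, S_zero, pow_zero, mul_one, map_one]
      simp [e1, e2, WZ, II, gS]
  linear_combination (-P * (1+WZ)) * hQN + Q * (1 - WZ) * hK - P * (1+WZ) * Q * N * II_mul

theorem sZ_nat (n : ℕ) : sTildeZ n = S n := by simp [sTildeZ, S]
theorem sZ_neg (m : ℤ) (h : m < 0) : sTildeZ m = 0 := by rw [sTildeZ, if_neg (by omega)]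

theorem sh_rec (m : ℤ) : sh (sTildeZ m) = - (Polynomial.X * sh (sTildeZ (m-1))) +
    Polynomial.C (sTildeZ m) - Polynomial.X * Polynomial.C (sTildeZ (m-1)) := by
  rcases lt_trichotomy m 0 with h | h | h
  · simp [sZ_neg m h, sZ_neg (m-1) (by omega)]
  · subst h
    rw [sZ_neg (0-1) (by omega), show (0:ℤ) = ((0:ℕ):ℤ) by rfl, sZ_nat, S_zero]; simp
  · obtain ⟨n, rfl⟩ : ∃ n : ℕ, m = ((n+1:ℕ):ℤ) := ⟨(m-1).toNat, by omega⟩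
    rw [show ((n+1:ℕ):ℤ) - 1 = (n:ℕ) by push_cast; ring, sZ_nat, sZ_nat]
    have h := congrArg (PowerSeries.coeff (n+1)) shSS
    rw [mul_add, mul_sub, mul_one, mul_one, map_add, map_sub, WZ, mul_left_comm,
      mul_left_comm _ (PowerSeries.C _), PowerSeries.coeff_C_mul, PowerSeries.coeff_C_mul,
      PowerSeries.coeff_succ_mul_X, PowerSeries.coeff_succ_mul_X] at h
    simp only [PowerSeries.coeff_map, SS, PowerSeries.coeff_mk, RingHom.coe_coe] at h
    linear_combination h

def c (k : ℕ) : ℂ := if k = 0 then 1 else 2 * (-1)^k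

theorem sh_coeff (k : ℕ) : ∀ m : ℤ, (sh (sTildeZ m)).coeff k = c k • sTildeZ (m - k) := by
  induction k with
  | zero => intro m; rw [sh_rec]; simp [c, Polynomial.mul_coeff_zero]
  | succ k ih =>
    intro m
    rw [sh_rec]
    simp only [Polynomial.coeff_sub, Polynomial.coeff_add, Polynomial.coeff_neg,
      Polynomial.coeff_X_mul, ih, Polynomial.coeff_C]
    rw [show m - 1 - (k:ℤ) = m - ((k+1:ℕ):ℤ) by push_cast; ring]
    rw [if_neg (by omega)]
    rcases Nat.eq_zero_or_pos k with h | h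
    · subst h; simp [c]; module
    · rw [if_neg (by omega), c, c, if_neg (by omega), if_neg (by omega)]
      rw [pow_succ]; module

def L (j : ℤ) : Polynomial BRing →ₗ[BRing] BRing :=
  Polynomial.lsum (fun k => LinearMap.mulLeft BRing (sTildeZ ((k:ℤ) - j)))

theorem phiHat_eq (j : ℤ) (p : BRing) : phiHat j p = sqrt2⁻¹ • L j (sh p) := by
  rw [phiHat, shiftMinus_eq, L, Polynomial.lsum_apply, Polynomial.sum]
  congr 1
  apply finsum_eq_sum_of_support_subset
  intro k hk
  simp only [Function.mem_support] at hk
  simp only [Finset.mem_coe, Polynomial.mem_support_iff]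
  intro h; apply hk; rw [h, mul_zero]

theorem L_X_pow (j : ℤ) (n : ℕ) (q : Polynomial BRing) :
    L j (Polynomial.X ^ n * q) = L (j - n) q := by
  induction q using Polynomial.induction_on' with
  | add p q hp hq => rw [mul_add, map_add, map_add, hp, hq]
  | monomial k a =>
    rw [Polynomial.X_pow_mul_monomial]
    simp only [L, Polynomial.lsum_apply]
    rw [Polynomial.sum_monomial_index _ _ (by simp), Polynomial.sum_monomial_index _ _ (by simp)]
    simp only [LinearMap.mulLeft_apply]
    congr 2; push_cast; ring

theorem L_C (j : ℤ) (a : BRing) (q : Polynomial BRing) : L j (Polynomial.C a * q) = a * L j q := by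
  rw [← Polynomial.smul_eq_C_mul, map_smul, smul_eq_mul]

theorem phi_add (j : ℤ) (p q : BRing) : phiHat j (p + q) = phiHat j p + phiHat j q := by
  simp only [phiHat_eq, map_add, smul_add]

theorem phi_C (j : ℤ) (a : ℂ) (q : BRing) :
    phiHat j (MvPolynomial.C a * q) = MvPolynomial.C a * phiHat j q := by
  rw [phiHat_eq, phiHat_eq, map_mul, show sh (MvPolynomial.C a) = Polynomial.C (MvPolynomial.C a) from
    sh.commutes a, L_C, mul_smul_comm]

theorem phi_sub (j : ℤ) (p q : BRing) : phiHat j (p - q) = phiHat j p - phiHat j q := by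
  simp only [phiHat_eq, map_sub, smul_sub]

theorem phi_X (j : ℤ) (k : ℕ) (q : BRing) :
    phiHat j (MvPolynomial.X k * q) = MvPolynomial.X k * phiHat j q -
      MvPolynomial.C ((2 : ℂ) / ((2 * k + 1 : ℕ) : ℂ)) * phiHat (j - (2*k+1:ℕ)) q := by
  have hs : sh (MvPolynomial.X k) = Polynomial.C (MvPolynomial.X k) -
      Polynomial.C (MvPolynomial.C ((2 : ℂ) / ((2 * k + 1 : ℕ) : ℂ))) *
        Polynomial.X ^ (2 * k + 1) := by simp [sh]
  rw [phiHat_eq, phiHat_eq, phiHat_eq, map_mul, hs, sub_mul, map_sub, L_C, mul_assoc, L_C, L_X_pow,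
    smul_sub, mul_smul_comm, mul_smul_comm]

theorem phi_one (j : ℤ) : phiHat j 1 = sqrt2⁻¹ • sTildeZ (-j) := by
  rw [phiHat_eq, map_one, L, Polynomial.lsum_apply, ← Polynomial.C_1,
    Polynomial.sum_C_index (by simp)]
  simp

theorem phi_s (i m : ℤ) (N : ℕ) (hN : m < N) : phiHat i (sTildeZ m) = sqrt2⁻¹ •
    ∑ k ∈ Finset.range N, c k • (sTildeZ (k - i) * sTildeZ (m - k)) := by
  rw [phiHat, shiftMinus_eq]
  congr 1
  rw [finsum_eq_sum_of_support_subset (s := Finset.range N)]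
  · refine Finset.sum_congr rfl fun k _ => ?_
    rw [sh_coeff, mul_smul_comm]
  · intro k hk
    simp only [Function.mem_support] at hk
    simp only [Finset.coe_range, Set.mem_Iio]
    by_contra h
    apply hk
    rw [sh_coeff, sZ_neg (m-k) (by omega)]; simp

def f (a b k : ℤ) : BRing := (-1:ℂ)^k • (sTildeZ (a + k) * sTildeZ (b - k))

theorem sum_split (g : ℤ → BRing) (N : ℕ) :
    ∑ k ∈ Finset.Ioo (-(N+1:ℤ)) (N+1), g k = g 0 + ∑ k ∈ Finset.range N, (g (k+1) + g (-(k+1))) := by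
  induction N with
  | zero => 
    rw [show Finset.Ioo (-(((0:ℕ):ℤ)+1)) (((0:ℕ):ℤ)+1) = {0} by ext; simp; omega]; simp
  | succ N ih =>
    rw [Finset.sum_range_succ, ← add_assoc, ← ih]
    have : Finset.Ioo (-(((N+1:ℕ):ℤ)+1)) (((N+1:ℕ):ℤ)+1) =
      insert ((N:ℤ)+1) (insert (-((N:ℤ)+1)) (Finset.Ioo (-(N+1:ℤ)) (N+1))) := by
      ext x; simp only [Finset.mem_insert, Finset.mem_Ioo]; push_cast; omega
    rw [this, Finset.sum_insert (by simp; omega), Finset.sum_insert (by simp)]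
    ring

theorem sum_f (a b : ℤ) (N : ℕ) (ha : |a| < N + 1) (hb : |b| < N + 1) :
    ∑ k ∈ Finset.Ioo (-(N+1:ℤ)) (N+1), f a b k = if a + b = 0 then MvPolynomial.C ((-1:ℂ)^a) else 0 := by
  rw [abs_lt] at ha hb
  rcases lt_or_ge (a + b) 0 with h | h
  · rw [if_neg (by omega)]
    apply Finset.sum_eq_zero
    intro k _
    rw [f]
    rcases lt_or_ge (a+k) 0 with h1 | h1
    · simp [sZ_neg _ h1]
    · simp [sZ_neg (b-k) (by omega)]
  · obtain ⟨n, hn⟩ := Int.eq_ofNat_of_zero_le h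
    have h2 := congrArg (fun x => (-1:ℂ)^(-a) • x) (conv n)
    have e : (-1:ℂ)^(-a) = (-1:ℂ)^a := by
      rw [zpow_neg, ← inv_zpow]; norm_num
    beta_reduce at h2
    have rhs : (if a + b = 0 then MvPolynomial.C ((-1:ℂ)^a) else 0 : BRing) =
      (-1:ℂ)^(-a) • (if n = 0 then (1:BRing) else 0) := by
      have : a + b = 0 ↔ n = 0 := by omega
      simp only [this, e]; split_ifs
      · rw [MvPolynomial.smul_eq_C_mul, mul_one]
      · simp
    rw [rhs, ← h2, Finset.smul_sum]
    symm
    have inj : Set.InjOn (fun m : ℕ => (m:ℤ) - a) (Finset.range (n+1)) := by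
      intro x _ y _ hxy; simp only at hxy; omega
    have h3 : ∑ m ∈ Finset.range (n+1), (-1:ℂ)^(-a) • ((-1)^m * (S m * S (n-m))) =
        ∑ k ∈ (Finset.range (n+1)).image (fun m : ℕ => (m:ℤ) - a), f a b k := by
      rw [Finset.sum_image inj]
      refine Finset.sum_congr rfl fun m hm => ?_
      rw [Finset.mem_range] at hm
      rw [f, show a + ((m:ℤ) - a) = m by ring, show b - ((m:ℤ) - a) = ((n - m : ℕ) : ℤ) by omega,
        sZ_nat, sZ_nat, sub_eq_neg_add, zpow_add₀ (by norm_num), zpow_natCast, mul_smul]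
      congr 1
      rw [MvPolynomial.smul_eq_C_mul]; simp
    rw [h3]
    apply Finset.sum_subset
    · intro k hk
      simp only [Finset.mem_image, Finset.mem_range] at hk
      obtain ⟨m, hm, rfl⟩ := hk
      simp only [Finset.mem_Ioo]; omega
    · intro k _ hk
      rw [f]
      rcases lt_or_ge (a+k) 0 with h1 | h1
      · simp [sZ_neg _ h1]
      · rcases lt_or_ge (b-k) 0 with h4 | h4
        · simp [sZ_neg _ h4]
        · exfalso; apply hk
          simp only [Finset.mem_image, Finset.mem_range]
          exact ⟨(a+k).toNat, by omega, by omega⟩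

theorem sq2 : sqrt2⁻¹ * sqrt2⁻¹ = (2:ℂ)⁻¹ := by
  rw [← mul_inv, sqrt2, ← Complex.ofReal_mul, Real.mul_self_sqrt (by norm_num)]; norm_num

theorem phi_smul (j : ℤ) (a : ℂ) (q : BRing) : phiHat j (a • q) = a • phiHat j q := by
  rw [MvPolynomial.smul_eq_C_mul, MvPolynomial.smul_eq_C_mul, phi_C]

theorem anti_one (i j : ℤ) : phiHat i (phiHat j 1) + phiHat j (phiHat i 1) =
    if i = -j then MvPolynomial.C ((-1 : ℂ) ^ i) else 0 := by
  obtain ⟨N, hi, hj⟩ : ∃ N : ℕ, |-i| < (N:ℤ) + 1 ∧ |-j| < (N:ℤ) + 1 :=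
    ⟨i.natAbs + j.natAbs, by rw [abs_neg]; push_cast; have := abs_nonneg j; omega,
      by rw [abs_neg]; push_cast; have := abs_nonneg i; omega⟩
  have main := sum_f (-i) (-j) N hi hj
  rw [sum_split] at main
  rw [abs_lt] at hi hj
  rw [phi_one, phi_one, phi_smul, phi_smul, phi_s i (-j) (N+1) (by push_cast; omega),
    phi_s j (-i) (N+1) (by push_cast; omega), smul_smul, smul_smul, sq2, ← smul_add,
    ← Finset.sum_add_distrib, Finset.sum_range_succ']
  have e : (-1:ℂ)^(-i) = (-1:ℂ)^i := by
    rw [zpow_neg, ← inv_zpow]; norm_num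
  have rhs : (if i = -j then MvPolynomial.C ((-1 : ℂ) ^ i) else 0 : BRing) =
      if -i + -j = 0 then MvPolynomial.C ((-1 : ℂ) ^ (-i)) else 0 := by
    rw [e]; congr 1; apply propext; omega
  rw [rhs, ← main, smul_add, Finset.smul_sum, add_comm]
  congr 1
  · simp only [f, c]; simp only [Nat.cast_zero, zero_sub, sub_zero, add_zero, zpow_zero, one_smul, if_true]
    rw [mul_comm (sTildeZ (-j))]; module
  · refine Finset.sum_congr rfl fun k _ => ?_
    have e1 : (-1:ℂ)^(-((k:ℤ)+1)) = (-1:ℂ)^(k+1) := by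
      rw [zpow_neg, ← inv_zpow]; norm_num; norm_cast
    have e2 : (-1:ℂ)^((k:ℤ)+1) = (-1:ℂ)^(k+1) := by norm_cast
    rw [f, f, c, if_neg (by omega), e1, e2]
    rw [show ((k+1:ℕ):ℤ) - i = -i + (k+1) by push_cast; ring,
      show -j - ((k+1:ℕ):ℤ) = -j - (k+1) by push_cast; ring,
      show ((k+1:ℕ):ℤ) - j = -j - -((k:ℤ)+1) by push_cast; ring,
      show -i - ((k+1:ℕ):ℤ) = -i + -((k:ℤ)+1) by push_cast; ring,
      mul_comm (sTildeZ (-j - -((k:ℤ)+1)))]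
    module

theorem anti (p : BRing) : ∀ i j : ℤ, phiHat i (phiHat j p) + phiHat j (phiHat i p) =
    (if i = -j then MvPolynomial.C ((-1 : ℂ) ^ i) else 0) * p := by
  induction p using MvPolynomial.induction_on with
  | C a =>
    intro i j
    rw [← mul_one (MvPolynomial.C a), phi_C, phi_C, phi_C, phi_C, ← mul_add, anti_one]; ring
  | add p q hp hq =>
    intro i j
    rw [phi_add, phi_add, phi_add, phi_add, mul_add, ← hp, ← hq]; ring
  | mul_X p k hp =>
    intro i j
    rw [mul_comm p, phi_X, phi_X, phi_sub, phi_sub, phi_X, phi_X, phi_C, phi_C]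
    have h1 := hp i j
    have h2 := hp (i - (2*k+1:ℕ)) j
    have h3 := hp i (j - (2*k+1:ℕ))
    have hc : (if i - (2*k+1:ℕ) = -j then MvPolynomial.C ((-1 : ℂ) ^ (i - (2*k+1:ℕ))) else 0 : BRing) +
      (if i = -(j - (2*k+1:ℕ)) then MvPolynomial.C ((-1 : ℂ) ^ i) else 0) = 0 := by
      have : i - (2*k+1:ℕ) = -j ↔ i = -(j - (2*k+1:ℕ)) := by omega
      simp only [this]
      split_ifs
      · rw [← MvPolynomial.C_add, zpow_sub₀ (by norm_num), zpow_natCast, Odd.neg_one_pow ⟨k, rfl⟩,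
          show (-1:ℂ)^i / -1 + (-1)^i = 0 by ring, MvPolynomial.C_0]
      · simp
    linear_combination MvPolynomial.X k * h1 -
      MvPolynomial.C ((2 : ℂ) / ((2 * k + 1 : ℕ) : ℂ)) * (h2 + h3 + p * hc)

end PhiAux

end

noncomputable section

/-- The operators `φ̂_j` (`j ∈ ℤ`) on `B = ℂ[t₁,t₃,t₅,…]` defined by the
vertex operator generating series satisfy the anticommutation relations of the type `B`
Clifford algebra: `φ̂_i φ̂_j + φ̂_j φ̂_i = (-1)^i δ_{i,-j} · id_B` for all `i, j ∈ ℤ`; in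
particular `φ̂_0² = (1/2) id_B`. -/
theorem phiHat_anticommute :
    (∀ (i j : ℤ) (p : BRing),
        phiHat i (phiHat j p) + phiHat j (phiHat i p) =
          if i = -j then ((-1 : ℂ) ^ i) • p else 0) ∧
    (∀ p : BRing, phiHat 0 (phiHat 0 p) = (2 : ℂ)⁻¹ • p) := by
  have h1 : ∀ (i j : ℤ) (p : BRing),
        phiHat i (phiHat j p) + phiHat j (phiHat i p) =
          if i = -j then ((-1 : ℂ) ^ i) • p else 0 := by
    intro i j p
    rw [PhiAux.anti]
    split_ifs
    · rw [MvPolynomial.smul_eq_C_mul]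
    · rw [zero_mul]
  refine ⟨h1, fun p => ?_⟩
  have h := h1 0 0 p
  rw [if_pos (by simp), zpow_zero, one_smul] at h
  have h2 : (2:ℂ) • phiHat 0 (phiHat 0 p) = p := by rw [two_smul]; exact h
  exact (inv_smul_eq_iff₀ (by norm_num)).mpr h2.symm |>.symm

end
end

section
/- The operators φ̂_a (a ∈ ½ + ℤ) on B_D = ℂ[θ] ⊗ ℂ[t_1,t_3,t_5,…] defined from the type-D vertex operator satisfy the anticommutation relations of the type-D Clifford algebra: φ̂_a φ̂_b + φ̂_b φ̂_a = δ_{a,−b} · id for all a, b ∈ ½ + ℤ. -/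
noncomputable section

open Polynomial in
def shM : BRing →ₐ[ℂ] Polynomial BRing :=
  MvPolynomial.aeval
    (fun i => Polynomial.C (MvPolynomial.X i) -
      Polynomial.C (MvPolynomial.C ((2 : ℂ) / ((2 * i + 1 : ℕ) : ℂ))) *
        Polynomial.X ^ (2 * i + 1))

lemma shiftMinus_eq (p : BRing) : shiftMinus p = shM p := rfl

lemma shM_X (i : ℕ) : shM (MvPolynomial.X i) = Polynomial.C (MvPolynomial.X i) -
      Polynomial.C (MvPolynomial.C ((2 : ℂ) / ((2 * i + 1 : ℕ) : ℂ))) *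
        Polynomial.X ^ (2 * i + 1) := by simp [shM]

lemma shM_C (c : ℂ) : shM (MvPolynomial.C c) = Polynomial.C (MvPolynomial.C c) := by
  simp [shM]

def hN (n : ℕ) : BRing := MvPolynomial.aeval tTilde (schurPoly n)

lemma hN_zero : hN 0 = 1 := by simp [hN, schurPoly]

lemma hN_succ (n : ℕ) : hN (n+1) * ((n : BRing) + 1) =
    ∑ j ∈ Finset.range (n + 1), (((j : BRing) + 1) * tTilde (j+1)) * hN (n - j) := by
  have h1 : ((n : ℂ) + 1) ≠ 0 := by exact_mod_cast Nat.succ_ne_zero n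
  have h2 : ((n : BRing) + 1) = MvPolynomial.C ((n : ℂ) + 1) := by simp
  rw [hN, schurPoly, map_smul, map_sum, h2, mul_comm, MvPolynomial.smul_eq_C_mul, ← mul_assoc,
    ← MvPolynomial.C_mul, mul_inv_cancel₀ h1, MvPolynomial.C_1, one_mul]
  refine Finset.sum_congr rfl fun j _ => ?_
  rw [map_smul, map_mul, MvPolynomial.aeval_X, MvPolynomial.smul_eq_C_mul, hN]
  simp [mul_assoc]

open PowerSeries

def HS : PowerSeries BRing := PowerSeries.mk hN
def TS : PowerSeries BRing := PowerSeries.mk fun j => ((j : BRing) + 1) * tTilde (j+1)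

lemma HS_deriv : derivative BRing HS = TS * HS := by
  ext1 n
  rw [coeff_derivative, PowerSeries.coeff_mul, Finset.Nat.sum_antidiagonal_eq_sum_range_succ_mk]
  simp only [HS, TS, PowerSeries.coeff_mk]
  exact hN_succ n

lemma ode_unique {R : Type*} [CommRing R] [Algebra ℚ R] (A F : PowerSeries R)
    (hF : derivative R F = A * F) (h0 : coeff 0 F = 0) : F = 0 := by
  ext1 n
  rw [map_zero]
  induction n using Nat.strong_induction_on with
  | _ n ih =>
    cases n with
    | zero => exact h0
    | succ n =>
      have h := congrArg (coeff n) hF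
      rw [coeff_derivative, PowerSeries.coeff_mul, Finset.Nat.sum_antidiagonal_eq_sum_range_succ_mk,
        Finset.sum_eq_zero] at h
      · have hu : IsUnit ((n : R) + 1) := by
          have : ((n : R) + 1) = algebraMap ℚ R ((n : ℚ) + 1) := by simp
          rw [this]
          exact (IsUnit.mk0 _ (by positivity)).map _
        exact (hu.mul_left_eq_zero).1 h
      · intro j hj
        rw [ih (n - j) (by omega), mul_zero]

/-- `H(-z)` -/
def HM : PowerSeries BRing := PowerSeries.mk fun n => (-1)^n * hN n

lemma HM_deriv : derivative BRing HM = - TS * HM := by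
  ext1 n
  rw [coeff_derivative, PowerSeries.coeff_mul, Finset.Nat.sum_antidiagonal_eq_sum_range_succ_mk]
  simp only [HM, TS, PowerSeries.coeff_mk, map_neg]
  rw [mul_assoc, hN_succ n, Finset.mul_sum]
  refine Finset.sum_congr rfl fun j hj => ?_
  have hj' : j ≤ n := by simpa [Nat.lt_succ_iff] using hj
  obtain ⟨k, rfl⟩ := Nat.exists_eq_add_of_le hj'
  simp only [Nat.add_sub_cancel_left]
  rcases Nat.even_or_odd j with he | ho
  · have : (-1 : BRing)^j = 1 := he.neg_one_pow
    rw [pow_succ, pow_add, this]; ring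
  · have : tTilde (j+1) = 0 := by
      rw [tTilde, if_neg]; obtain ⟨r, rfl⟩ := ho; omega
    rw [this]; ring

lemma HS_HM : HS * HM = 1 := by
  have h : HS * HM - 1 = 0 := by
    apply ode_unique 0
    · rw [map_sub, Derivation.leibniz, HS_deriv, HM_deriv, Derivation.map_one_eq_zero]
      simp only [smul_eq_mul]; ring
    · simp [HS, HM, hN_zero]
  exact sub_eq_zero.1 h

lemma hh_sum (n : ℕ) : ∑ x ∈ Finset.HasAntidiagonal.antidiagonal n, hN x.1 * ((-1)^x.2 * hN x.2) =
    if n = 0 then 1 else 0 := by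
  have h := congrArg (coeff n) HS_HM
  rw [PowerSeries.coeff_mul, PowerSeries.coeff_one] at h
  simpa [HS, HM] using h

/-- `U = ∑_{j odd} w^j z^{j-1}` -/
def US : PowerSeries (Polynomial BRing) :=
  PowerSeries.mk fun n => if n % 2 = 0 then (Polynomial.X)^(n+1) else 0

abbrev wz : PowerSeries (Polynomial BRing) := PowerSeries.C Polynomial.X * PowerSeries.X

lemma US_eq : US * ((1 + wz) * (1 - wz)) = PowerSeries.C Polynomial.X := by
  have : (1 + wz) * (1 - wz) = 1 - PowerSeries.C (Polynomial.X^2) * PowerSeries.X^2 := by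
    simp only [map_pow]; ring
  rw [this, mul_sub, mul_one, mul_left_comm]
  ext1 n
  rw [map_sub, PowerSeries.coeff_C_mul, PowerSeries.coeff_mul_X_pow', PowerSeries.coeff_C]
  rcases n with _ | _ | n
  · simp [US]
  · simp [US]
  · simp only [US, PowerSeries.coeff_mk]
    have h1 : (n + 1 + 1) % 2 = n % 2 := by omega
    have h2 : 2 ≤ n + 1 + 1 := by omega
    have h3 : ¬ (n + 1 + 1 = 0) := by omega
    rw [h1, if_pos h2, if_neg h3, show n + 1 + 1 - 2 = n by omega]
    split_ifs <;> ring

abbrev HW : PowerSeries (Polynomial BRing) := PowerSeries.map Polynomial.C HS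
abbrev HQ : PowerSeries (Polynomial BRing) := PowerSeries.map shM.toRingHom HS

lemma deriv_map {R S : Type*} [CommRing R] [CommRing S] (f : R →+* S) (F : PowerSeries R) :
    derivative S (PowerSeries.map f F) = PowerSeries.map f (derivative R F) := by
  ext1 n
  rw [coeff_derivative, PowerSeries.coeff_map, PowerSeries.coeff_map, coeff_derivative]
  simp

lemma psderiv_mul {R : Type*} [CommRing R] (F G : PowerSeries R) :
    derivative R (F * G) = F * derivative R G + G * derivative R F :=
  Derivation.leibniz _ _ _

lemma psderiv_one {R : Type*} [CommRing R] :
    derivative R (1 : PowerSeries R) = 0 := Derivation.map_one_eq_zero _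

lemma deriv_CX {R : Type*} [CommRing R] (c : R) :
    derivative R (PowerSeries.C c * PowerSeries.X) = PowerSeries.C c := by
  rw [psderiv_mul, derivative_X, derivative_C]; ring

lemma TS_map : PowerSeries.map shM.toRingHom TS = PowerSeries.map Polynomial.C TS - 2 * US := by
  ext1 n
  rw [show (2 : PowerSeries (Polynomial BRing)) = PowerSeries.C 2 from (map_ofNat PowerSeries.C 2).symm, map_sub,
    PowerSeries.coeff_C_mul]
  simp only [TS, US, PowerSeries.coeff_map, PowerSeries.coeff_mk]
  rcases Nat.even_or_odd' n with ⟨i, rfl | rfl⟩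
  · have : tTilde (2 * i + 1) = MvPolynomial.X i := by
      rw [tTilde, if_pos (by omega)]; congr 1; omega
    rw [this, if_pos (by omega), map_mul]
    have h2 : shM.toRingHom (MvPolynomial.X i : BRing) = _ := shM_X i
    have h3 : (((2 * i : ℕ) : BRing) + 1) = MvPolynomial.C (((2 * i + 1 : ℕ) : ℂ)) := by
      rw [map_natCast]; push_cast; rfl
    have h4 : shM.toRingHom (MvPolynomial.C (((2 * i + 1 : ℕ) : ℂ)) : BRing) = _ := shM_C _
    rw [h2, h3, h4, map_mul, mul_sub, ← mul_assoc, ← map_mul, ← map_mul,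
      ← map_mul, mul_div_cancel₀ (2 : ℂ) (Nat.cast_ne_zero.2 (Nat.succ_ne_zero (2 * i)))]
    rw [map_ofNat, map_ofNat]
  · have : tTilde (2 * i + 1 + 1) = 0 := by
      rw [tTilde, if_neg (by omega)]
    rw [this, if_neg (by omega)]
    simp

lemma HQ_eq : (1 + wz) * HQ = (1 - wz) * HW := by
  have hw : derivative (Polynomial BRing) wz = PowerSeries.C Polynomial.X := by
    exact deriv_CX _
  have hQ : derivative _ HQ = (PowerSeries.map Polynomial.C TS - 2 * US) * HQ := by
    rw [deriv_map, HS_deriv, map_mul, TS_map]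
  have hW : derivative _ HW = PowerSeries.map Polynomial.C TS * HW := by
    rw [deriv_map, HS_deriv, map_mul]
  have h : (1 + wz) * HQ - (1 - wz) * HW = 0 := by
    apply ode_unique (PowerSeries.map Polynomial.C TS - US * (1 + wz))
    · have h2 : derivative _ ((1 - wz) * HW) =
          (PowerSeries.map Polynomial.C TS - US * (1 + wz)) * ((1 - wz) * HW) := by
        rw [psderiv_mul, hW, map_sub, hw, psderiv_one, ← US_eq]
        ring
      have h3 : derivative _ ((1 + wz) * HQ) =
          (PowerSeries.map Polynomial.C TS - US * (1 + wz)) * ((1 + wz) * HQ) := by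
        rw [psderiv_mul, hQ, map_add, hw, psderiv_one, ← US_eq]
        ring
      rw [map_sub, h2, h3]; ring
    · simp only [map_sub, sub_mul, add_mul, one_mul, map_add, wz, mul_assoc, PowerSeries.coeff_C_mul,
        PowerSeries.coeff_zero_X_mul, PowerSeries.coeff_map, HS, PowerSeries.coeff_mk, hN_zero]
      simp
  exact sub_eq_zero.1 h

lemma shM_rec (n : ℕ) : shM (hN (n+1)) + Polynomial.X * shM (hN n) =
    Polynomial.C (hN (n+1)) - Polynomial.X * Polynomial.C (hN n) := by
  have h := congrArg (coeff (n+1)) HQ_eq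
  simp only [add_mul, sub_mul, one_mul, wz, map_add, map_sub, mul_assoc,
    PowerSeries.coeff_C_mul, PowerSeries.coeff_succ_X_mul] at h
  simpa [HS] using h

def qq (a : ℕ) : BRing := if a = 0 then 1 else 2 * (-1)^a

lemma coeff_shM_hN (n a : ℕ) : (shM (hN n)).coeff a = if a ≤ n then qq a * hN (n - a) else 0 := by
  induction n generalizing a with
  | zero =>
    rcases a with _ | a
    · simp [hN_zero, qq]
    · simp [hN_zero, Polynomial.coeff_one]
  | succ n ih =>
    rw [eq_sub_of_add_eq (shM_rec n)]
    rcases a with _ | a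
    · simp [qq]
    · simp only [Polynomial.coeff_sub, Polynomial.coeff_X_mul, ih, Polynomial.coeff_C_succ,
        Polynomial.coeff_C]
      rcases a with _ | a
      · simp [qq]; ring
      · by_cases h : a + 1 ≤ n
        · simp [h, qq, pow_succ]
        · simp [h]

/-! second part -/

open Polynomial in
lemma swap_coeff (f : Polynomial (Polynomial BRing)) (a b : ℕ) :
    ((Bivariate.swap f).coeff a).coeff b = (f.coeff b).coeff a := by
  induction f using Polynomial.induction_on' with
  | add f g hf hg => simp only [map_add, Polynomial.coeff_add, hf, hg]
  | monomial n c =>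
    induction c using Polynomial.induction_on' with
    | add f g hf hg => simp only [map_add, Polynomial.coeff_add, hf, hg]
    | monomial m c =>
      rw [Bivariate.swap_monomial_monomial]
      simp only [Polynomial.coeff_monomial]
      split_ifs <;> simp_all [Polynomial.coeff_monomial]

def DD : BRing →+* Polynomial (Polynomial BRing) :=
  (Polynomial.mapRingHom shM.toRingHom).comp shM.toRingHom

lemma DD_coeff (p : BRing) (l b : ℕ) : ((DD p).coeff l).coeff b = (shM ((shM p).coeff l)).coeff b := by
  simp [DD]

lemma DD_X (i : ℕ) : DD (MvPolynomial.X i) = Polynomial.C (Polynomial.C (MvPolynomial.X i)) -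
    Polynomial.C (Polynomial.C (MvPolynomial.C ((2 : ℂ) / ((2 * i + 1 : ℕ) : ℂ)))) *
      (Polynomial.C Polynomial.X ^ (2 * i + 1) + Polynomial.X ^ (2 * i + 1)) := by
  have h : DD (MvPolynomial.X i) = (shM (MvPolynomial.X i)).map shM.toRingHom := rfl
  rw [h, shM_X, Polynomial.map_sub, Polynomial.map_mul, Polynomial.map_C, Polynomial.map_C,
    Polynomial.map_pow, Polynomial.map_X]
  have h2 : shM.toRingHom (MvPolynomial.X i : BRing) = _ := shM_X i
  have h4 (c : ℂ) : shM.toRingHom (MvPolynomial.C c : BRing) = _ := shM_C _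
  rw [h2, h4, map_sub, map_mul, map_pow]; ring

lemma DD_C (c : ℂ) : DD (MvPolynomial.C c) = Polynomial.C (Polynomial.C (MvPolynomial.C c)) := by
  have h : DD (MvPolynomial.C c) = (shM (MvPolynomial.C c)).map shM.toRingHom := rfl
  have h4 (c : ℂ) : shM.toRingHom (MvPolynomial.C c : BRing) = _ := shM_C _
  rw [h, shM_C, Polynomial.map_C, h4]

open Polynomial in
lemma swap_sub' {R : Type*} [CommRing R] (f g : Polynomial (Polynomial R)) :
    Bivariate.swap (f - g) = Bivariate.swap f - Bivariate.swap g := by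
  rw [eq_sub_iff_add_eq, ← map_add, sub_add_cancel]

open Polynomial in
lemma DD_swap (p : BRing) : Bivariate.swap (DD p) = DD p := by
  have : (Bivariate.swap (R := BRing)).toRingEquiv.toRingHom.comp DD = DD := by
    apply MvPolynomial.ringHom_ext
    · intro c
      change Bivariate.swap (DD (MvPolynomial.C c)) = _
      rw [DD_C, Bivariate.swap_C_C]
    · intro i
      change Bivariate.swap (DD (MvPolynomial.X i)) = _
      have hs (f g : Polynomial (Polynomial BRing)) : Bivariate.swap (f - g) =
        Bivariate.swap f - Bivariate.swap g := swap_sub' f g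
      rw [DD_X, hs, map_mul, map_add, map_pow, map_pow, Bivariate.swap_C_C, Bivariate.swap_C_C,
        Bivariate.swap_X, Bivariate.swap_Y, add_comm (Polynomial.X ^ _)]
  exact RingHom.congr_fun this p

def PP (p : BRing) (l b : ℕ) : BRing := (shM ((shM p).coeff l)).coeff b

lemma PP_symm (p : BRing) (l b : ℕ) : PP p l b = PP p b l := by
  rw [PP, PP, ← DD_coeff, ← DD_coeff, ← swap_coeff, DD_swap]

lemma DD_eval (p : BRing) : (DD p).eval (-Polynomial.X) = Polynomial.C p := by
  have : (Polynomial.evalRingHom (-Polynomial.X)).comp DD = Polynomial.C := by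
    apply MvPolynomial.ringHom_ext
    · intro c
      simp [DD_C]
    · intro i
      rw [RingHom.comp_apply, DD_X]
      have : Odd (2 * i + 1) := ⟨i, rfl⟩
      rw [Polynomial.coe_evalRingHom, Polynomial.eval_sub, Polynomial.eval_mul, Polynomial.eval_add, Polynomial.eval_pow, Polynomial.eval_pow, Polynomial.eval_C,Polynomial.eval_C,Polynomial.eval_C, Polynomial.eval_X, neg_pow (Polynomial.X : Polynomial BRing), this.neg_one_pow]
      ring
  exact RingHom.congr_fun this p

lemma PP_alt (p : BRing) (N : ℕ) (hN : (shM p).natDegree < N) (n : ℕ) :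
    ∑ l ∈ Finset.range N, (if l ≤ n then (-1)^l * PP p l (n - l) else 0) =
      if n = 0 then p else 0 := by
  have h := congrArg (Polynomial.coeff · n) (DD_eval p)
  have hd : (DD p).natDegree < N := lt_of_le_of_lt (Polynomial.natDegree_map_le) hN
  simp only [Polynomial.eval_eq_sum_range' hd, Polynomial.finsetSum_coeff, Polynomial.coeff_C] at h
  rw [← h]
  refine Finset.sum_congr rfl fun l _ => ?_
  rw [neg_pow (Polynomial.X : Polynomial BRing), ← mul_assoc, Polynomial.coeff_mul_X_pow', 
    show ((-1 : Polynomial BRing)^l) = Polynomial.C ((-1)^l) by simp, Polynomial.coeff_mul_C, DD_coeff, PP]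
  split_ifs <;> ring

lemma hZ_nat (n : ℕ) : sTildeZ (n : ℤ) = hN n := by simp [sTildeZ, hN]

lemma hZ_neg {m : ℤ} (h : m < 0) : sTildeZ m = 0 := by simp [sTildeZ, not_le.2 h]

lemma coeff_shM_hZ (m : ℤ) (a : ℕ) :
    (shM (sTildeZ m)).coeff a = qq a * sTildeZ (m - a) := by
  rcases lt_or_ge m 0 with h | h
  · rw [hZ_neg h, hZ_neg (by omega)]; simp
  · lift m to ℕ using h
    rw [hZ_nat, coeff_shM_hN]
    split_ifs with h
    · rw [← Nat.cast_sub h, hZ_nat]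
    · rw [hZ_neg (by omega), mul_zero]

def LL (i : ℤ) : Polynomial BRing →ₗ[BRing] BRing :=
  Polynomial.lsum (fun k => LinearMap.mulLeft BRing (sTildeZ ((k : ℤ) - i)))

lemma LL_monomial (i : ℤ) (k : ℕ) (c : BRing) :
    LL i (Polynomial.monomial k c) = sTildeZ ((k : ℤ) - i) * c := by
  simp [LL, Polynomial.lsum_apply, Polynomial.sum_monomial_index]

lemma LL_range (i : ℤ) (f : Polynomial BRing) (N : ℕ) (h : f.natDegree < N) :
    LL i f = ∑ k ∈ Finset.range N, sTildeZ ((k : ℤ) - i) * f.coeff k := by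
  conv_lhs => rw [f.as_sum_range' N h]
  rw [map_sum]
  exact Finset.sum_congr rfl fun k _ => LL_monomial _ _ _

lemma LL_mul (i : ℤ) (f g : Polynomial BRing) (K N : ℕ) (hf : f.natDegree < K)
    (hg : g.natDegree < N) :
    LL i (f * g) = ∑ b ∈ Finset.range N, ∑ a ∈ Finset.range K,
      sTildeZ (((a + b : ℕ) : ℤ) - i) * (f.coeff a * g.coeff b) := by
  conv_lhs => rw [f.as_sum_range' K hf, g.as_sum_range' N hg]
  rw [Finset.mul_sum, map_sum]
  refine Finset.sum_congr rfl fun b _ => ?_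
  rw [Finset.sum_mul, map_sum]
  refine Finset.sum_congr rfl fun a _ => ?_
  rw [Polynomial.monomial_mul_monomial, LL_monomial]

lemma vertexB_LL (j : ℤ) (p : BRing) : vertexB j p = LL j (shM p) := by
  rw [LL_range j (shM p) _ (Nat.lt_succ_self _), vertexB]
  apply finsum_eq_sum_of_support_subset
  intro k hk
  simp only [Function.mem_support, shiftMinus_eq] at hk
  have : (shM p).coeff k ≠ 0 := right_ne_zero_of_mul hk
  have := Polynomial.le_natDegree_of_ne_zero this
  simp; omega

lemma vv (i j : ℤ) (p : BRing) (N K : ℕ) (hN : (shM p).natDegree < N)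
    (hN' : ∀ l < N, (shM ((shM p).coeff l)).natDegree < N)
    (hK : ∀ l < N, (l : ℤ) - j < K) (hK0 : 0 < K) :
    vertexB i (vertexB j p) = ∑ l ∈ Finset.range N, ∑ b ∈ Finset.range N, PP p l b *
      ∑ a ∈ Finset.range K, qq a * (sTildeZ ((l : ℤ) - j - a) * sTildeZ ((b : ℤ) - i + a)) := by
  rw [vertexB_LL, vertexB_LL, LL_range j _ N hN, map_sum, map_sum]
  refine Finset.sum_congr rfl fun l hl => ?_
  have hl := Finset.mem_range.1 hl
  rw [map_mul, LL_mul i _ _ K N _ (hN' l hl)]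
  · refine Finset.sum_congr rfl fun b _ => ?_
    rw [Finset.mul_sum]
    refine Finset.sum_congr rfl fun a _ => ?_
    rw [coeff_shM_hZ, PP, show (((a + b : ℕ) : ℤ) - i) = (b : ℤ) - i + a by push_cast; ring]
    ring
  · obtain ⟨K, rfl⟩ : ∃ K', K = K' + 1 := ⟨K - 1, by omega⟩
    rw [Nat.lt_succ_iff, Polynomial.natDegree_le_iff_coeff_eq_zero]
    intro a ha
    have := hK l hl
    rw [coeff_shM_hZ, hZ_neg (by push_cast at this; omega), mul_zero]

def sg (m : ℤ) : BRing := (((Int.negOnePow m : ℤˣ) : ℤ) : BRing)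

lemma sg_add (m n : ℤ) : sg (m + n) = sg m * sg n := by
  simp [sg, Int.negOnePow_add]

lemma sg_neg (m : ℤ) : sg (-m) = sg m := by
  simp [sg, Int.negOnePow_neg]

lemma sg_nat (n : ℕ) : sg n = (-1)^n := by
  simp [sg, Int.negOnePow_def]

lemma sg_sub (m n : ℤ) : sg (m - n) = sg m * sg n := by
  rw [sub_eq_add_neg, sg_add, sg_neg]

lemma hsum1 (r : ℤ) (M : ℕ) (hM : r < M) :
    ∑ c ∈ Finset.range M, (-1)^c * (sTildeZ (c : ℤ) * sTildeZ (r - c)) = if r = 0 then 1 else 0 := by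
  rcases lt_or_ge r 0 with h | h
  · rw [if_neg (by omega)]
    refine Finset.sum_eq_zero fun c _ => ?_
    rw [hZ_neg (m := r - c) (by omega)]; ring
  · lift r to ℕ using h
    have h2 := hh_sum r
    rw [← Finset.Nat.sum_antidiagonal_swap, Finset.Nat.sum_antidiagonal_eq_sum_range_succ_mk] at h2
    simp only [Prod.swap] at h2
    simp only [Nat.cast_eq_zero]
    rw [← h2]
    rw [← Finset.sum_subset (s₁ := Finset.range (r + 1)) (s₂ := Finset.range M)]
    · refine Finset.sum_congr rfl fun c hc => ?_
      have : c ≤ r := by simpa [Nat.lt_succ_iff] using hc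
      rw [← Nat.cast_sub this, hZ_nat, hZ_nat]; ring
    · intro c; simp; omega
    · intro c _ hc
      have : r < c := by simpa using hc
      rw [hZ_neg (m := (r : ℤ) - c) (by omega)]; ring

lemma symsum (g : ℤ → BRing) (K : ℕ) :
    ∑ a ∈ Finset.range (K + 1), (if a = 0 then 1 else 2) * g a +
    ∑ a ∈ Finset.range (K + 1), (if a = 0 then 1 else 2) * g (-a) =
    2 * ∑ c ∈ Finset.range (2 * K + 1), g (K - c) := by
  induction K with
  | zero => simp; ring
  | succ K ih =>
    rw [Finset.sum_range_succ _ (K+1), Finset.sum_range_succ _ (K+1),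
      show 2 * (K + 1) + 1 = (2 * K + 1) + 1 + 1 by ring, Finset.sum_range_succ _ (2 * K + 1 + 1),
      Finset.sum_range_succ' _ (2 * K + 1)]
    have h : ∀ c : ℕ, g (((K + 1 : ℕ) : ℤ) - ((c + 1 : ℕ) : ℤ)) = g ((K : ℤ) - c) := by
      intro c; congr 1; push_cast; ring
    simp only [h]
    rw [show ((K : ℤ) - ((2 * K + 1 : ℕ) : ℤ)) = -((K + 1 : ℕ) : ℤ) by push_cast; ring,
      show (((K + 1 : ℕ) : ℤ) - ((0 : ℕ) : ℤ)) = ((K + 1 : ℕ) : ℤ) by push_cast; ring]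
    rw [if_neg (Nat.succ_ne_zero K)]
    linear_combination ih

lemma cc (m n : ℤ) (K : ℕ) (hm : m ≤ K) (hm' : -K ≤ m) (hn : n ≤ K) :
    ∑ a ∈ Finset.range (K + 1), qq a * (sTildeZ (m - a) * sTildeZ (n + a)) +
    ∑ a ∈ Finset.range (K + 1), qq a * (sTildeZ (n - a) * sTildeZ (m + a)) =
    if m + n = 0 then 2 * sg m else 0 := by
  have h := symsum (fun a => sg a * (sTildeZ (m - a) * sTildeZ (n + a))) K
  have hq (a : ℕ) : qq a = (if a = 0 then 1 else 2) * sg a := by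
    rw [qq, sg_nat]; split_ifs with h
    · simp [h]
    · rfl
  have e : ∀ a : ℕ, qq a * (sTildeZ (n - a) * sTildeZ (m + a)) =
     (if a = 0 then 1 else 2) * (sg (-a) * (sTildeZ (m - -a) * sTildeZ (n + -a))) := by
    intro a
    rw [hq, sg_neg, sub_neg_eq_add, ← sub_eq_add_neg]; ring
  have e' : ∀ a : ℕ, qq a * (sTildeZ (m - a) * sTildeZ (n + a)) =
     (if a = 0 then 1 else 2) * (sg (a) * (sTildeZ (m - a) * sTildeZ (n + a))) := by
    intro a
    rw [hq]; ring
  rw [Finset.sum_congr rfl (fun a _ => e a), Finset.sum_congr rfl (fun a _ => e' a)]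
  rw [h]
  obtain ⟨D, hD⟩ := Int.eq_ofNat_of_zero_le (a := (K : ℤ) - m) (by omega)
  obtain ⟨M, hM⟩ := Int.eq_ofNat_of_zero_le (a := (K : ℤ) + m + 1) (by omega)
  have hDM : 2 * K + 1 = D + M := by omega
  rw [hDM, Finset.sum_range_add, Finset.sum_eq_zero, zero_add]
  · have h3 : ∀ x : ℕ, sg ((K : ℤ) - ((D + x : ℕ) : ℤ)) * (sTildeZ (m - ((K : ℤ) - ((D + x : ℕ) : ℤ)))
        * sTildeZ (n + ((K : ℤ) - ((D + x : ℕ) : ℤ)))) =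
        sg m * ((-1)^x * (sTildeZ (x : ℤ) * sTildeZ (m + n - x))) := by
      intro x
      rw [show ((K : ℤ) - ((D + x : ℕ) : ℤ)) = m - x by push_cast; omega, sg_sub, sg_nat,
        show m - (m - (x : ℤ)) = x by ring, show n + (m - (x : ℤ)) = m + n - x by ring]
      ring
    rw [Finset.sum_congr rfl (fun x _ => h3 x), ← Finset.mul_sum, hsum1 _ _ (by omega)]
    split_ifs <;> ring
  · intro c hc
    have := Finset.mem_range.1 hc
    rw [hZ_neg (m := m - ((K : ℤ) - c)) (by omega)]; ring

lemma vertexB_anti (i j : ℤ) (p : BRing) :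
    vertexB i (vertexB j p) + vertexB j (vertexB i p) = if i + j = 0 then 2 * sg i * p else 0 := by
  obtain ⟨N, hN, hN'⟩ : ∃ N : ℕ, (shM p).natDegree < N ∧
      ∀ l, (shM ((shM p).coeff l)).natDegree < N := by
    refine ⟨(shM p).natDegree + 1 + (Finset.range ((shM p).natDegree + 1)).sup
      (fun l => (shM ((shM p).coeff l)).natDegree), by omega, fun l => ?_⟩
    by_cases hl : l < (shM p).natDegree + 1
    · have := Finset.le_sup (f := fun l => (shM ((shM p).coeff l)).natDegree) (Finset.mem_range.2 hl)
      omega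
    · rw [Polynomial.coeff_eq_zero_of_natDegree_lt (by omega)]; simp
  obtain ⟨K, hK⟩ : ∃ K : ℕ, K = N + i.natAbs + j.natAbs := ⟨_, rfl⟩
  rw [vv i j p N (K+1) hN (fun l _ => hN' l) (by intro l hl; push_cast; omega) (by omega),
    vv j i p N (K+1) hN (fun l _ => hN' l) (by intro l hl; push_cast; omega) (by omega)]
  rw [Finset.sum_comm (s := Finset.range N) (t := Finset.range N) (f := fun l b => PP p l b *
      ∑ a ∈ Finset.range (K+1), qq a * (sTildeZ ((l : ℤ) - i - a) * sTildeZ ((b : ℤ) - j + a)))]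
  rw [← Finset.sum_add_distrib]
  have h1 : ∀ l ∈ Finset.range N, (∑ b ∈ Finset.range N, PP p l b *
      ∑ a ∈ Finset.range (K+1), qq a * (sTildeZ ((l : ℤ) - j - a) * sTildeZ ((b : ℤ) - i + a))) +
      (∑ b ∈ Finset.range N, PP p b l *
      ∑ a ∈ Finset.range (K+1), qq a * (sTildeZ ((b : ℤ) - i - a) * sTildeZ ((l : ℤ) - j + a))) =
      ∑ b ∈ Finset.range N, PP p l b *
        (if (l : ℤ) - j + (b - i) = 0 then 2 * sg (l - j) else 0) := by
    intro l hl
    have hl := Finset.mem_range.1 hl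
    rw [← Finset.sum_add_distrib]
    refine Finset.sum_congr rfl fun b hb => ?_
    have hb := Finset.mem_range.1 hb
    rw [PP_symm p b l, ← mul_add, cc _ _ K (by omega) (by omega) (by omega)]
  rw [Finset.sum_congr rfl h1]
  rcases lt_or_ge (i + j) 0 with h | h
  · rw [if_neg (by omega)]
    refine Finset.sum_eq_zero fun l _ => Finset.sum_eq_zero fun b _ => ?_
    rw [if_neg (by omega), mul_zero]
  · obtain ⟨n, hn⟩ := Int.eq_ofNat_of_zero_le h
    have h2 : ∀ l ∈ Finset.range N, ∑ b ∈ Finset.range N, PP p l b *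
        (if (l : ℤ) - j + (b - i) = 0 then 2 * sg (l - j) else 0) =
        2 * sg j * (if l ≤ n then (-1)^l * PP p l (n - l) else 0) := by
      intro l hl
      split_ifs with hln
      · rw [Finset.sum_eq_single (n - l)]
        · rw [if_pos (by omega), sg_sub, sg_nat]; ring
        · intro b _ hb
          rw [if_neg (by omega), mul_zero]
        · intro hb
          have hb : N ≤ n - l := by simpa using hb
          rw [PP, Polynomial.coeff_eq_zero_of_natDegree_lt (lt_of_lt_of_le (hN' l) hb), zero_mul]
      · rw [mul_zero]
        refine Finset.sum_eq_zero fun b _ => ?_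
        rw [if_neg (by omega), mul_zero]
    rw [Finset.sum_congr rfl h2, ← Finset.mul_sum, PP_alt p N hN n]
    by_cases h0 : n = 0
    · have : j = -i := by omega
      rw [if_pos h0, if_pos (by omega), this, sg_neg]
    · rw [if_neg h0, if_neg (by omega), mul_zero]

def VL (j : ℤ) : BRing →ₗ[ℂ] BRing := (LL j).restrictScalars ℂ ∘ₗ shM.toLinearMap

lemma vertexB_VL (j : ℤ) (p : BRing) : vertexB j p = VL j p := vertexB_LL j p

lemma sg_smul (i : ℤ) (p : BRing) : sg i * p = ((-1 : ℂ)^i) • p := by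
  rw [MvPolynomial.smul_eq_C_mul, sg]
  congr 1
  rcases Int.even_or_odd i with h | h
  · rw [h.neg_one_zpow, Int.negOnePow_even i h]; simp
  · rw [h.neg_one_zpow, Int.negOnePow_odd i h]; simp

lemma VL_anti (i j : ℤ) (p : BRing) :
    VL i (VL j p) + VL j (VL i p) = (if i + j = 0 then 2 * (-1 : ℂ)^i else 0) • p := by
  have h := vertexB_anti i j p
  simp only [vertexB_VL] at h
  rw [h]
  split_ifs
  · rw [mul_assoc, sg_smul, mul_smul, two_mul, two_smul]
  · simp

lemma sq2 : sqrt2⁻¹ * sqrt2⁻¹ = (1 / 2 : ℂ) := by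
  rw [← mul_inv, sqrt2, ← Complex.ofReal_mul, Real.mul_self_sqrt (by norm_num)]; simp

/-- `√2 (α Φ_k + β Ψ)` -/
def OP (α β : ℂ) (k : ℤ) (p : BD) : BD :=
  (sqrt2⁻¹ • (α • VL k p.2 - β • p.2), sqrt2⁻¹ • (α • VL k p.1 + β • p.1))

lemma OP_anti (α β α' β' : ℂ) (k k' : ℤ) (p : BD) :
    OP α β k (OP α' β' k' p) + OP α' β' k' (OP α β k p) =
      (α * α' * (if k + k' = 0 then (-1 : ℂ)^k else 0) - β * β') • p := by
  have key (q : BRing) : VL k' (VL k q) = (if k + k' = 0 then 2 * (-1 : ℂ)^k else 0) • q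
      - VL k (VL k' q) := eq_sub_of_add_eq' (VL_anti k k' q)
  have e : (if k + k' = 0 then 2 * (-1 : ℂ)^k else 0) = 2 * (if k + k' = 0 then (-1 : ℂ)^k else 0) := by
    split_ifs <;> simp
  rw [e] at key
  generalize (if k + k' = 0 then (-1 : ℂ)^k else 0) = d at key
  obtain ⟨p, q⟩ := p
  have hs := sq2
  simp only [OP, Prod.mk_add_mk, Prod.smul_mk, map_smul, map_add, map_sub, key]
  generalize sqrt2⁻¹ = s at hs
  refine Prod.ext ?_ ?_
  · simp only
    trans (s * s) • ((2 * (α * α' * d - β * β')) • p)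
    · module
    · rw [hs]; module
  · simp only
    trans (s * s) • ((2 * (α * α' * d - β * β')) • q)
    · module
    · rw [hs]; module

lemma phiD_OP (m : ℤ) : ∃ (α β : ℂ) (k : ℤ), (∀ p, phiD m p = OP α β k p) ∧
    ((m ≤ -2 ∧ α = 1 ∧ β = 0 ∧ k = m + 1) ∨ (m = -1 ∧ α = sqrt2⁻¹ ∧ β = sqrt2⁻¹ ∧ k = 0) ∨
    (m = 0 ∧ α = sqrt2⁻¹ ∧ β = -sqrt2⁻¹ ∧ k = 0) ∨ (1 ≤ m ∧ α = (-1 : ℂ)^m ∧ β = 0 ∧ k = m)) := by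
  have hm : m ≤ -2 ∨ m = -1 ∨ m = 0 ∨ 1 ≤ m := by omega
  rcases hm with h | h | h | h
  · refine ⟨_, _, _, fun p => ?_, Or.inl ⟨h, rfl, rfl, rfl⟩⟩
    rw [phiD, if_pos h]
    refine Prod.ext ?_ ?_ <;> simp [OP, PhiHatD, vertexB_VL]
  · refine ⟨_, _, _, fun p => ?_, Or.inr (Or.inl ⟨h, rfl, rfl, rfl⟩)⟩
    rw [phiD, if_neg (by omega), if_pos h]
    refine Prod.ext ?_ ?_ <;> simp [OP, PhiHatD, PsiD, vertexB_VL] <;> module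
  · refine ⟨_, _, _, fun p => ?_, Or.inr (Or.inr (Or.inl ⟨h, rfl, rfl, rfl⟩))⟩
    rw [phiD, if_neg (by omega), if_neg (by omega), if_pos h]
    refine Prod.ext ?_ ?_ <;> simp [OP, PhiHatD, PsiD, vertexB_VL] <;> module
  · refine ⟨_, _, _, fun p => ?_, Or.inr (Or.inr (Or.inr ⟨h, rfl, rfl, rfl⟩))⟩
    rw [phiD, if_neg (by omega), if_neg (by omega), if_neg (by omega)]
    refine Prod.ext ?_ ?_ <;> simp [OP, PhiHatD, vertexB_VL] <;> module

end

noncomputable section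

theorem phiD_anticommute (m m' : ℤ) (p : BD) :
    phiD m (phiD m' p) + phiD m' (phiD m p) = if m + m' = -1 then p else 0 := by
  have hs := sq2
  have hite : (if m + m' = -1 then p else 0) = (if m + m' = -1 then (1 : ℂ) else 0) • p := by
    split_ifs <;> simp
  rw [hite]
  have hone (m : ℤ) : (-1 : ℂ)^m * (-1 : ℂ)^m = 1 := by
    rw [← mul_zpow]; simp
  obtain ⟨α, β, k, h1, h2⟩ := phiD_OP m
  obtain ⟨α', β', k', h1', h2'⟩ := phiD_OP m'
  simp only [h1, h1', OP_anti]
  congr 1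
  rcases h2 with ⟨h, rfl, rfl, rfl⟩ | ⟨rfl, rfl, rfl, rfl⟩ | ⟨rfl, rfl, rfl, rfl⟩ | ⟨h, rfl, rfl, rfl⟩ <;>
  rcases h2' with ⟨h', rfl, rfl, rfl⟩ | ⟨rfl, rfl, rfl, rfl⟩ | ⟨rfl, rfl, rfl, rfl⟩ | ⟨h', rfl, rfl, rfl⟩
  all_goals first
    | (rw [if_neg (by omega), if_neg (by omega)]; ring)
    | (norm_num [hs]; done)
    | skip
  · by_cases e : m + k' = -1
    · rw [if_pos (by omega), if_pos e, show m + 1 = -k' by omega, zpow_neg,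
        mul_comm, one_mul, inv_mul_cancel₀ (zpow_ne_zero _ (by norm_num))]; ring
    · rw [if_neg (by omega), if_neg e]; ring
  · by_cases e : k + m' = -1
    · rw [if_pos (by omega), if_pos e]; linear_combination hone k
    · rw [if_neg (by omega), if_neg e]; ring

end
end

section
/- Let τ ∈ B = ℂ[t_1,t_3,t_5,…] be a nonzero polynomial satisfying the BKP bilinear identity, and let v = Σ_{j∈ℤ} a_j φ̂_j be an operator on B with a_j ∈ ℂ and a_j = 0 for all sufficiently negative j (so v p is a well-defined polynomial for every p ∈ B). Then v τ is either zero or again satisfies the BKP bilinear identity. -/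
namespace BKPProof

noncomputable section

open MvPolynomial

/-! ### Schur polynomials and generating series -/

section gen

variable {R : Type} [CommRing R] [Algebra ℂ R]

def S (n : ℕ) (c : ℕ → R) : R := MvPolynomial.aeval c (schurPoly n)

lemma S_zero (c : ℕ → R) : S 0 c = 1 := by
  simp [S, schurPoly]

lemma S_succ (n : ℕ) (c : ℕ → R) :
    ((n : R) + 1) * S (n + 1) c =
      ∑ j ∈ Finset.range (n + 1), ((j : R) + 1) * (c (j + 1) * S (n - j) c) := by
  have hn : ((n : ℂ) + 1) ≠ 0 := by exact_mod_cast Nat.succ_ne_zero n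
  have h2 : ∀ k : ℕ, ((k : R) + 1) = algebraMap ℂ R ((k : ℂ) + 1) := by intro k; simp
  have h1 : S (n + 1) c = ((n + 1 : ℂ))⁻¹ • ∑ j ∈ Finset.range (n + 1),
      ((j + 1 : ℂ)) • (c (j + 1) * S (n - j) c) := by
    unfold S
    rw [schurPoly]
    simp only [map_smul, map_sum, map_mul, aeval_X]
  rw [h1, h2, ← Algebra.smul_def, smul_smul, mul_inv_cancel₀ hn, one_smul]
  refine Finset.sum_congr rfl fun j _ => ?_
  rw [h2, ← Algebra.smul_def]

/-- uniqueness for the recursion -/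
lemma S_unique (c : ℕ → R) (f : PowerSeries R) (h0 : PowerSeries.constantCoeff f = 1)
    (hf : PowerSeries.derivative R f =
      PowerSeries.mk (fun j => ((j : R) + 1) * c (j + 1)) * f) (n : ℕ) :
    PowerSeries.coeff n f = S n c := by
  induction n using Nat.strong_induction_on with
  | _ n ih =>
    rcases n with _ | n
    · simpa [S_zero] using h0
    · have hn : IsUnit ((n : R) + 1) := by
        have : ((n : R) + 1) = algebraMap ℂ R ((n : ℂ) + 1) := by simp
        rw [this]
        exact (IsUnit.mk0 _ (by exact_mod_cast Nat.succ_ne_zero n)).map _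
      apply hn.mul_left_cancel
      rw [S_succ]
      have := congrArg (PowerSeries.coeff n) hf
      rw [PowerSeries.coeff_derivative, PowerSeries.coeff_mul,
        Finset.Nat.sum_antidiagonal_eq_sum_range_succ_mk] at this
      rw [mul_comm, this]
      refine Finset.sum_congr rfl fun j hj => ?_
      rw [PowerSeries.coeff_mk, ih (n - j) (by omega), mul_assoc]

def genE (c : ℕ → R) : PowerSeries R := PowerSeries.mk fun n => S n c

lemma genE_deriv (c : ℕ → R) : PowerSeries.derivative R (genE c) =
      PowerSeries.mk (fun j => ((j : R) + 1) * c (j + 1)) * genE c := by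
  ext n
  rw [PowerSeries.coeff_derivative, PowerSeries.coeff_mul,
        Finset.Nat.sum_antidiagonal_eq_sum_range_succ_mk]
  simp only [genE, PowerSeries.coeff_mk]
  rw [mul_comm, S_succ]
  exact Finset.sum_congr rfl fun j _ => (mul_assoc _ _ _).symm

lemma genE_unique (c : ℕ → R) (f : PowerSeries R) (h0 : PowerSeries.constantCoeff f = 1)
    (hf : PowerSeries.derivative R f =
      PowerSeries.mk (fun j => ((j : R) + 1) * c (j + 1)) * f) : f = genE c := by
  ext n
  rw [S_unique c f h0 hf, genE, PowerSeries.coeff_mk]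

lemma genE_const (c : ℕ → R) : PowerSeries.constantCoeff (genE c) = 1 := by
  rw [← PowerSeries.coeff_zero_eq_constantCoeff_apply]
  simp [genE, S_zero]

lemma genE_add (c d : ℕ → R) : genE (fun j => c j + d j) = genE c * genE d := by
  symm
  apply genE_unique
  · simp [genE_const]
  · rw [Derivation.leibniz, genE_deriv, genE_deriv]
    have : (PowerSeries.mk (fun j : ℕ => ((j : R) + 1) * (c (j + 1) + d (j+1)))) =
      PowerSeries.mk (fun j : ℕ => ((j : R) + 1) * (c (j + 1))) +
      PowerSeries.mk (fun j : ℕ => ((j : R) + 1) * (d (j + 1))) := by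
      ext n; simp [mul_add]
    rw [this]
    simp only [smul_eq_mul]
    ring

lemma genE_zero : genE (fun _ => (0 : R)) = 1 := by
  symm
  apply genE_unique
  · simp
  · have : (PowerSeries.mk (fun j : ℕ => ((j : R) + 1) * 0)) = 0 := by ext n; simp
    rw [this]
    simp

/-- coefficients of (1-x)/(1+x) -/
def kap (k : ℕ) : ℂ := if k = 0 then 1 else 2 * (-1) ^ k

lemma genE_geom [IsDomain R] (w : R) :
    genE (fun j => if j % 2 = 1 then -(algebraMap ℂ R (2 / (j : ℂ)) * w ^ j) else 0) =
      PowerSeries.mk fun k => algebraMap ℂ R (kap k) * w ^ k := by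
  symm
  set K : PowerSeries R := PowerSeries.mk fun k => algebraMap ℂ R (kap k) * w ^ k with hK
  apply genE_unique
  · rw [← PowerSeries.coeff_zero_eq_constantCoeff_apply]; simp [hK, kap]
  set U : PowerSeries R := PowerSeries.mk _ with hU
  have hU1 : ∀ n, PowerSeries.coeff n U = if n % 2 = 0 then -2 * w ^ (n+1) else 0 := by
    intro n
    rw [hU, PowerSeries.coeff_mk]
    rcases Nat.mod_two_eq_zero_or_one n with h | h
    · rw [if_pos (by omega), if_pos h]
      have hn : ((n : ℂ) + 1) ≠ 0 := by exact_mod_cast Nat.succ_ne_zero n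
      have h2 : ((n : R) + 1) = algebraMap ℂ R ((n : ℂ) + 1) := by simp
      rw [h2, mul_neg, ← mul_assoc, ← map_mul]
      have : ((n : ℂ) + 1) * (2 / ((n + 1 : ℕ) : ℂ)) = 2 := by
        push_cast; field_simp
      rw [this, show algebraMap ℂ R 2 = 2 from map_ofNat _ 2]
      ring
    · rw [if_neg (by omega), if_neg (by omega), mul_zero]
  set W : PowerSeries R := PowerSeries.C w with hW
  have e1 : K * (1 + W * PowerSeries.X) = 1 - W * PowerSeries.X := by
    ext n
    rcases n with _ | _ | n
    · simp [hK, kap]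
    · have h3 : K * (1 + W * PowerSeries.X) = K + W * K * PowerSeries.X := by ring
      rw [h3]
      simp [hK, hW, PowerSeries.coeff_succ_mul_X, kap,
        PowerSeries.coeff_one]
      rw [show algebraMap ℂ R 2 = 2 from map_ofNat _ 2]
      ring
    · have h3 : K * (1 + W * PowerSeries.X) = K + W * K * PowerSeries.X := by ring
      rw [h3]
      simp [hK, hW, PowerSeries.coeff_succ_mul_X, kap,
        PowerSeries.coeff_one]
      ring
  have e2 : U * (1 - W ^ 2 * PowerSeries.X ^ 2) = - 2 * W := by
    have h3 : U * (1 - W ^ 2 * PowerSeries.X ^ 2)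
      = U - PowerSeries.C (w ^ 2) * U * PowerSeries.X ^ 2 := by rw [map_pow]; ring
    have h4 : - 2 * W = PowerSeries.C (-2 * w) := by
      rw [map_mul, map_neg, show PowerSeries.C (2 : R) = 2 from map_ofNat _ 2]
    rw [h3, h4]
    ext n
    rcases n with _ | _ | n
    · simp [hU1, PowerSeries.coeff_mul_X_pow', PowerSeries.coeff_C]
      rw [← PowerSeries.coeff_zero_eq_constantCoeff_apply, hU1]
      simp
    · simp [hU1, PowerSeries.coeff_mul_X_pow', PowerSeries.coeff_C]
    · rw [map_sub, show n + 1 + 1 = n + 2 from rfl, PowerSeries.coeff_mul_X_pow, PowerSeries.coeff_C_mul, hU1, hU1,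
        PowerSeries.coeff_C]
      have : (n + 2) % 2 = n % 2 := by omega
      rw [this]
      rw [if_neg (by omega : ¬ n + 2 = 0)]
      split_ifs <;> ring
  have e3 : PowerSeries.derivative R K * (1 + W * PowerSeries.X) + K * W = - W := by
    have := congrArg (PowerSeries.derivative R) e1
    simp only [Derivation.leibniz, map_add, map_sub, smul_eq_mul, hW] at this
    simp at this
    rw [← hW] at this
    linear_combination this
  have hne : (1 + W * PowerSeries.X : PowerSeries R) * (1 - W * PowerSeries.X) ≠ 0 := by
    intro h0
    have := congrArg PowerSeries.constantCoeff h0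
    simp at this
  apply mul_right_cancel₀ hne
  linear_combination (1 - W * PowerSeries.X) * e3 - K * e2 + W * e1

end gen


/-! ### The vertex operator as a linear map -/

/-- linear functional on polynomials in `w` -/
def Lf (m : ℤ) (q : Polynomial BRing) : BRing := ∑ᶠ k : ℕ, sTildeZ (m + k) * q.coeff k

def Rf (m : ℤ) (q : Polynomial BRing) : BRing := ∑ᶠ k : ℕ, sTildeNegZ (m + k) * q.coeff k

/-- common generalization -/
def Gf (s : ℤ → BRing) (m : ℤ) : Polynomial BRing →ₗ[BRing] BRing :=
  Polynomial.lsum (fun k => LinearMap.lsmul BRing BRing (s (m + k)))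

lemma Gf_monomial (s : ℤ → BRing) (m : ℤ) (k : ℕ) (c : BRing) :
    Gf s m (Polynomial.monomial k c) = s (m + k) * c := by
  simp [Gf, Polynomial.lsum_apply]

lemma Gf_eq (s : ℤ → BRing) (m : ℤ) (q : Polynomial BRing) :
    ∑ᶠ k : ℕ, s (m + k) * q.coeff k = Gf s m q := by
  rw [finsum_eq_sum_of_support_subset (s := q.support)]
  · simp [Gf, Polynomial.lsum_apply, Polynomial.sum]
  · intro k hk
    simp only [Function.mem_support] at hk
    simp only [Finset.mem_coe, Polynomial.mem_support_iff]
    intro h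
    simp [h] at hk

lemma Gf_C_mul (s : ℤ → BRing) (m : ℤ) (c : BRing) (q : Polynomial BRing) :
    Gf s m (Polynomial.C c * q) = c * Gf s m q := by
  rw [← Polynomial.smul_eq_C_mul, map_smul, smul_eq_mul]

lemma Gf_X_pow_mul (s : ℤ → BRing) (m : ℤ) (k : ℕ) (q : Polynomial BRing) :
    Gf s m (Polynomial.X ^ k * q) = Gf s (m + k) q := by
  induction q using Polynomial.induction_on' with
  | add p q hp hq => rw [mul_add, map_add, map_add, hp, hq]
  | monomial n c =>
    rw [← Polynomial.monomial_one_right_eq_X_pow, Polynomial.monomial_mul_monomial,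
      Gf_monomial, Gf_monomial, one_mul]
    push_cast
    rw [add_assoc]

/-- shiftMinus as alg hom -/
def shM : BRing →ₐ[ℂ] Polynomial BRing :=
  MvPolynomial.aeval
    (fun i => Polynomial.C (MvPolynomial.X i) -
      Polynomial.C (MvPolynomial.C ((2 : ℂ) / ((2 * i + 1 : ℕ) : ℂ))) *
        Polynomial.X ^ (2 * i + 1))

def shP : BRing →ₐ[ℂ] Polynomial BRing :=
  MvPolynomial.aeval
    (fun i => Polynomial.C (MvPolynomial.X i) +
      Polynomial.C (MvPolynomial.C ((2 : ℂ) / ((2 * i + 1 : ℕ) : ℂ))) *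
        Polynomial.X ^ (2 * i + 1))

/-- the vertex operator mode -/
def V (m : ℤ) : BRing →ₗ[ℂ] BRing := ((Gf sTildeZ m).restrictScalars ℂ) ∘ₗ shM.toLinearMap

lemma V_apply (m : ℤ) (p : BRing) : V m p = Gf sTildeZ m (shM p) := rfl

def Vr (m : ℤ) : BRing →ₗ[ℂ] BRing := ((Gf sTildeNegZ m).restrictScalars ℂ) ∘ₗ shP.toLinearMap

lemma Vr_apply (m : ℤ) (p : BRing) : Vr m p = Gf sTildeNegZ m (shP p) := rfl

lemma leftCoeff_eq (p : BRing) (m : ℤ) : leftCoeff p m = V m p := Gf_eq _ _ _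

lemma rightCoeff_eq (p : BRing) (m : ℤ) : rightCoeff p m = Vr m p := Gf_eq _ _ _

lemma phiHat_eq (p : BRing) (j : ℤ) : phiHat j p = sqrt2⁻¹ • V (-j) p := by
  have : ∀ k : ℕ, (k : ℤ) - j = -j + k := fun k => by ring
  simp only [phiHat, this]
  rw [Gf_eq]
  rfl

def cf (i : ℕ) : ℂ := (2 : ℂ) / ((2 * i + 1 : ℕ) : ℂ)

lemma V_X_mul (m : ℤ) (i : ℕ) (p : BRing) :
    V m (X i * p) = X i * V m p - cf i • V (m + (2 * i + 1 : ℕ)) p := by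
  rw [V_apply, map_mul]
  have : shM (X i) = Polynomial.C (MvPolynomial.X i) -
      Polynomial.C (MvPolynomial.C (cf i)) * Polynomial.X ^ (2 * i + 1) := by
    simp [shM, cf]
  rw [this, sub_mul, map_sub, mul_assoc, Gf_C_mul, Gf_C_mul, Gf_X_pow_mul,
    ← MvPolynomial.smul_eq_C_mul]
  rfl

lemma Vr_X_mul (m : ℤ) (i : ℕ) (p : BRing) :
    Vr m (X i * p) = X i * Vr m p + cf i • Vr (m + (2 * i + 1 : ℕ)) p := by
  rw [Vr_apply, map_mul]
  have : shP (X i) = Polynomial.C (MvPolynomial.X i) +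
      Polynomial.C (MvPolynomial.C (cf i)) * Polynomial.X ^ (2 * i + 1) := by
    simp [shP, cf]
  rw [this, add_mul, map_add, mul_assoc, Gf_C_mul, Gf_C_mul, Gf_X_pow_mul,
    ← MvPolynomial.smul_eq_C_mul]
  rfl

lemma V_one (m : ℤ) : V m 1 = sTildeZ m := by
  rw [V_apply, map_one, ← Polynomial.monomial_zero_one, Gf_monomial]; simp

lemma Vr_one (m : ℤ) : Vr m 1 = sTildeNegZ m := by
  rw [Vr_apply, map_one, ← Polynomial.monomial_zero_one, Gf_monomial]; simp

lemma sTildeZ_nat (n : ℕ) : sTildeZ n = S n tTilde := by simp [sTildeZ, S]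

lemma sTildeZ_neg {m : ℤ} (h : m < 0) : sTildeZ m = 0 := by simp [sTildeZ, h]

lemma S_neg (n : ℕ) : S n (fun j => - tTilde j) = (-1) ^ n * S n tTilde := by
  induction n using Nat.strong_induction_on with
  | _ n ih =>
    rcases n with _ | n
    · simp [S_zero]
    · have hn : ((n : BRing) + 1) ≠ 0 := by exact_mod_cast Nat.succ_ne_zero n
      apply mul_left_cancel₀ hn
      rw [S_succ, mul_left_comm, S_succ, Finset.mul_sum]
      refine Finset.sum_congr rfl fun j hj => ?_
      rw [Finset.mem_range] at hj
      rw [ih (n - j) (by omega)]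
      by_cases h : (j + 1) % 2 = 1
      · have : (-1 : BRing) ^ (n + 1) = - (-1) ^ (n - j) := by
          obtain ⟨r, hr⟩ : ∃ r, j = 2 * r := ⟨j / 2, by omega⟩
          have : n + 1 = (n - j) + 2 * r + 1 := by omega
          rw [this, pow_add, pow_add, pow_mul]
          have : n - j + 2 * r + 1 - 1 - j = n - j + 2 * r - j := by omega
          simp
        rw [this]; ring
      · simp [tTilde, h]

def ep (m : ℤ) : ℂ := (-1) ^ m

lemma ep_add (m n : ℤ) : ep (m + n) = ep m * ep n := zpow_add₀ (by norm_num) _ _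

lemma ep_neg (m : ℤ) : ep (-m) = ep m := by
  unfold ep
  rw [zpow_neg, ← inv_zpow]; norm_num

lemma ep_sq (m : ℤ) : ep m * ep m = 1 := by
  nth_rw 2 [← ep_neg]
  rw [← ep_add]; simp [ep]

lemma ep_odd (i : ℕ) : ep ((2 * i + 1 : ℕ) : ℤ) = -1 := by
  unfold ep
  rw [zpow_natCast]
  simp [pow_add, pow_mul]

lemma sTildeNegZ_eq (m : ℤ) : sTildeNegZ m = ep m • sTildeZ m := by
  by_cases h : 0 ≤ m
  · obtain ⟨n, rfl⟩ := Int.eq_ofNat_of_zero_le h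
    rw [sTildeZ_nat]
    have : sTildeNegZ (n : ℤ) = S n (fun j => - tTilde j) := by simp [sTildeNegZ, S]
    rw [this, S_neg, ep, zpow_natCast, MvPolynomial.smul_eq_C_mul]
    simp
  · simp [sTildeNegZ, sTildeZ, h]

lemma Vr_eq (p : BRing) : ∀ m : ℤ, Vr m p = ep m • V m p := by
  induction p using MvPolynomial.induction_on with
  | C a =>
    intro m
    have : (C a : BRing) = a • 1 := by rw [MvPolynomial.smul_eq_C_mul, mul_one]
    rw [this, map_smul, map_smul, V_one, Vr_one, sTildeNegZ_eq, smul_comm]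
  | add p q hp hq => intro m; rw [map_add, map_add, hp, hq, smul_add]
  | mul_X p i hp =>
    intro m
    rw [mul_comm p, V_X_mul, Vr_X_mul, hp, hp, ep_add, ep_odd, smul_sub]
    simp only [mul_smul_comm, smul_smul]
    rw [sub_eq_add_neg, ← neg_smul]
    congr 2
    ring

lemma V_vanish (p : BRing) (m : ℤ) (h : m < -((shM p).natDegree : ℤ)) : V m p = 0 := by
  rw [V_apply, ← Gf_eq]
  apply finsum_eq_zero_of_forall_eq_zero
  intro k
  by_cases hk : (shM p).natDegree < k
  · rw [Polynomial.coeff_eq_zero_of_natDegree_lt hk, mul_zero]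
  · rw [sTildeZ_neg (by omega), zero_mul]

/-! ### Clifford relations -/

lemma shM_tTilde (j : ℕ) : shM (tTilde j) = Polynomial.C (tTilde j) +
    (if j % 2 = 1 then -(algebraMap ℂ (Polynomial BRing) (2 / (j : ℂ)) * Polynomial.X ^ j)
      else 0) := by
  by_cases h : j % 2 = 1
  · obtain ⟨r, rfl⟩ : ∃ r, j = 2 * r + 1 := ⟨j / 2, by omega⟩
    simp only [tTilde, h, if_true]
    have : (2 * r + 1 - 1) / 2 = r := by omega
    rw [this]
    simp only [shM, aeval_X, sub_eq_add_neg]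
    rfl
  · simp [tTilde, h]

lemma algHom_S {R T : Type} [CommRing R] [Algebra ℂ R] [CommRing T] [Algebra ℂ T]
    (f : R →ₐ[ℂ] T) (n : ℕ) (c : ℕ → R) : f (S n c) = S n (fun j => f (c j)) := by
  unfold S
  rw [← MvPolynomial.comp_aeval_apply]

lemma shM_S (n : ℕ) : shM (S n tTilde) = ∑ k ∈ Finset.range (n + 1),
    Polynomial.C (S (n - k) tTilde) * (Polynomial.C (C (kap k)) * Polynomial.X ^ k) := by
  rw [algHom_S]
  simp only [shM_tTilde]
  have h := congrArg (PowerSeries.coeff n) (genE_add (fun j => Polynomial.C (tTilde j))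
    (fun j => if j % 2 = 1 then
      -(algebraMap ℂ (Polynomial BRing) (2 / (j : ℂ)) * Polynomial.X ^ j) else 0))
  rw [genE_geom, mul_comm, PowerSeries.coeff_mul,
    Finset.Nat.sum_antidiagonal_eq_sum_range_succ_mk] at h
  simp only [genE, PowerSeries.coeff_mk] at h
  rw [h]
  refine Finset.sum_congr rfl fun k _ => ?_
  have : Polynomial.C (S (n - k) tTilde) = S (n - k) (fun j => Polynomial.C (tTilde j)) :=
    algHom_S (Polynomial.CAlgHom (R := ℂ) (A := BRing)) _ _
  rw [this, mul_comm]
  rfl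

lemma V_s (m n : ℤ) (M : ℕ) (hM : n ≤ M) : V m (sTildeZ n) =
    ∑ k ∈ Finset.range (M + 1), kap k • (sTildeZ (n - k) * sTildeZ (m + k)) := by
  by_cases h : 0 ≤ n
  · obtain ⟨n, rfl⟩ := Int.eq_ofNat_of_zero_le h
    rw [sTildeZ_nat, V_apply, shM_S, map_sum]
    rw [← Finset.sum_subset (s₁ := Finset.range (n + 1)) (s₂ := Finset.range (M + 1))]
    · refine Finset.sum_congr rfl fun k hk => ?_
      rw [Finset.mem_range] at hk
      rw [Gf_C_mul, Gf_C_mul, ← mul_one (Polynomial.X ^ k), Gf_X_pow_mul,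
        ← Polynomial.monomial_zero_one, Gf_monomial, ← Nat.cast_sub (by omega), sTildeZ_nat,
        MvPolynomial.smul_eq_C_mul]
      simp
      ring
    · intro k; simp only [Finset.mem_range]; omega
    · intro k _ hk
      simp only [Finset.mem_range] at hk
      rw [sTildeZ_neg (by omega), zero_mul, smul_zero]
  · rw [sTildeZ_neg (by omega), map_zero]
    symm
    apply Finset.sum_eq_zero
    intro k _
    rw [sTildeZ_neg (by omega), zero_mul, smul_zero]

lemma sum_sym (g : ℤ → BRing) (m : ℤ) (M : ℕ) :
    ∑ k ∈ Finset.range (M + 1), g (m + k) + ∑ k ∈ Finset.range (M + 1), g (m - k) - g m =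
      ∑ i ∈ Finset.Icc (m - M) (m + M), g i := by
  induction M with
  | zero => simp
  | succ M ih =>
    rw [Finset.sum_range_succ, Finset.sum_range_succ _ (M + 1)]
    have : Finset.Icc (m - (M + 1 : ℕ)) (m + (M + 1 : ℕ)) =
      insert (m - (M + 1 : ℕ)) (insert (m + (M + 1 : ℕ)) (Finset.Icc (m - M) (m + M))) := by
      ext x
      simp only [Finset.mem_insert, Finset.mem_Icc]
      push_cast
      omega
    rw [this, Finset.sum_insert, Finset.sum_insert, ← ih]
    · ring
    · simp
    · simp only [Finset.mem_insert, Finset.mem_Icc]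
      push_cast
      omega

lemma sum_alt (r : ℕ) : ∑ i ∈ Finset.range (r + 1),
    ep i • (sTildeZ i * sTildeZ (r - i)) = if r = 0 then 1 else 0 := by
  have h := congrArg (PowerSeries.coeff r) (genE_add (fun j => - tTilde j) tTilde)
  simp only [neg_add_cancel] at h
  rw [genE_zero, PowerSeries.coeff_mul, PowerSeries.coeff_one,
    Finset.Nat.sum_antidiagonal_eq_sum_range_succ_mk] at h
  rw [h]
  refine Finset.sum_congr rfl fun k hk => ?_
  rw [Finset.mem_range] at hk
  simp only [genE, PowerSeries.coeff_mk]
  rw [S_neg, ← Nat.cast_sub (by omega), sTildeZ_nat, sTildeZ_nat, ep, zpow_natCast,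
    MvPolynomial.smul_eq_C_mul]
  simp [mul_assoc]

lemma clifford_one (m n : ℤ) : V m (V n 1) + V n (V m 1) =
    if m + n = 0 then (2 * ep m) • (1 : BRing) else 0 := by
  rw [V_one, V_one]
  set M : ℕ := m.natAbs + n.natAbs with hM
  rw [V_s m n M (by omega), V_s n m M (by omega)]
  set g : ℤ → BRing := fun i => ep i • (sTildeZ i * sTildeZ (m + n - i)) with hg
  have hk : ∀ k : ℕ, k ≠ 0 → kap k = 2 * ep k := by
    intro k hk; simp [kap, hk, ep]
  have key : ∀ x : ℕ → BRing, ∑ k ∈ Finset.range (M + 1), kap k • x k =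
      (2 : ℂ) • ∑ k ∈ Finset.range (M + 1), ep k • x k - x 0 := by
    intro x
    rw [Finset.sum_range_succ', Finset.sum_range_succ', smul_add, Finset.smul_sum]
    have : ∀ k ∈ Finset.range M, kap (k + 1) • x (k + 1) = (2 : ℂ) • ep (k + 1 : ℕ) • x (k + 1) := by
      intro k _
      rw [hk _ (by omega), smul_smul]
    rw [Finset.sum_congr rfl this]
    simp [kap, ep, two_smul]
    abel
  rw [key, key]
  have h1 : ∀ k : ℕ, ep k • (sTildeZ (n - k) * sTildeZ (m + k)) = ep m • g (m + k) := by
    intro k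
    rw [hg]
    simp only
    rw [smul_smul, ep_add, ← mul_assoc, ep_sq, one_mul, mul_comm (sTildeZ _)]
    congr 3
    ring
  have h2 : ∀ k : ℕ, ep k • (sTildeZ (m - k) * sTildeZ (n + k)) = ep m • g (m - k) := by
    intro k
    rw [hg]
    simp only
    rw [smul_smul, sub_eq_add_neg, ep_add, ← mul_assoc, ep_sq, one_mul, ep_neg]
    congr 3
    ring
  have h3 : sTildeZ (n - (0 : ℕ)) * sTildeZ (m + (0 : ℕ)) = ep m • g m := by
    have := h1 0
    simpa [ep] using this
  have h4 : sTildeZ (m - (0 : ℕ)) * sTildeZ (n + (0 : ℕ)) = ep m • g m := by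
    have := h2 0
    simpa [ep] using this
  rw [h3, h4]
  simp only [h1, h2]
  rw [← Finset.smul_sum, ← Finset.smul_sum]
  have h5 := sum_sym g m M
  have h6 : ∑ i ∈ Finset.Icc (m - M) (m + M), g i = if m + n = 0 then 1 else 0 := by
    by_cases hmn : 0 ≤ m + n
    · obtain ⟨r, hr⟩ := Int.eq_ofNat_of_zero_le hmn
      have : ∑ i ∈ Finset.Icc (m - M) (m + M), g i
          = ∑ i ∈ (Finset.range (r + 1)).map Nat.castEmbedding, g i := by
        symm
        apply Finset.sum_subset
        · intro i
          simp only [Finset.mem_map, Finset.mem_range, Finset.mem_Icc, Nat.castEmbedding_apply]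
          rintro ⟨j, hj, rfl⟩
          omega
        · intro i _ hi
          simp only [Finset.mem_map, Finset.mem_range, Nat.castEmbedding_apply] at hi
          simp only [hg]
          by_cases hi0 : i < 0
          · rw [sTildeZ_neg hi0, zero_mul, smul_zero]
          · have : ¬ i ≤ r := fun hir => hi ⟨i.toNat, by omega, by omega⟩
            rw [sTildeZ_neg (m := m + n - i) (by omega), mul_zero, smul_zero]
      rw [this, Finset.sum_map]
      simp only [hg, Nat.castEmbedding_apply, hr]
      rw [sum_alt]
      simp
    · rw [if_neg (by omega)]
      apply Finset.sum_eq_zero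
      intro i _
      simp only [hg]
      by_cases hi0 : i < 0
      · rw [sTildeZ_neg hi0, zero_mul, smul_zero]
      · rw [sTildeZ_neg (m := m + n - i) (by omega), mul_zero, smul_zero]
  rw [h6] at h5
  have h7 : (2 : ℂ) • ep m • ∑ k ∈ Finset.range (M + 1), g (m + k) - ep m • g m +
      ((2 : ℂ) • ep m • ∑ k ∈ Finset.range (M + 1), g (m - k) - ep m • g m) =
      (2 * ep m) • (∑ k ∈ Finset.range (M + 1), g (m + k) +
        ∑ k ∈ Finset.range (M + 1), g (m - k) - g m) := by
    module
  rw [h7, h5]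
  split_ifs <;> simp

lemma clifford (p : BRing) : ∀ m n : ℤ, V m (V n p) + V n (V m p) =
    if m + n = 0 then (2 * ep m) • p else 0 := by
  induction p using MvPolynomial.induction_on with
  | C a =>
    intro m n
    have : (C a : BRing) = a • 1 := by rw [MvPolynomial.smul_eq_C_mul, mul_one]
    simp only [this, map_smul, ← smul_add, clifford_one]
    split_ifs
    · rw [smul_comm]
    · simp
  | add p q hp hq =>
    intro m n
    simp only [map_add]
    have := congrArg₂ (· + ·) (hp m n) (hq m n)
    rw [add_add_add_comm, this]
    split_ifs <;> simp
  | mul_X p i hp =>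
    intro m n
    rw [mul_comm p]
    set k : ℤ := ((2 * i + 1 : ℕ) : ℤ) with hk
    have h1 := hp m n
    have h2 := hp (m + k) n
    have h3 := hp m (n + k)
    simp only [V_X_mul, map_sub, map_smul, ← hk]
    have h4 : X i * V m (V n p) - cf i • V (m + k) (V n p) - cf i • V m (V (n + k) p) +
        (X i * V n (V m p) - cf i • V (n + k) (V m p) - cf i • V n (V (m + k) p)) =
        X i * (V m (V n p) + V n (V m p)) -
          cf i • ((V (m + k) (V n p) + V n (V (m + k) p)) +
            (V m (V (n + k) p) + V (n + k) (V m p))) := by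
      rw [mul_add]; module
    rw [h4, h1, h2, h3]
    have h5 : (m + k + n = 0) ↔ (m + (n + k) = 0) := by constructor <;> intro h <;> linarith
    simp only [h5]
    have h6 : ((if m + (n + k) = 0 then (2 * ep (m + k)) • p else 0) +
      if m + (n + k) = 0 then (2 * ep m) • p else 0) = 0 := by
      split_ifs
      · rw [ep_add, ep_odd]; module
      · simp
    rw [h6, smul_zero, sub_zero]
    split_ifs <;> simp

/-! ### Tensor square of a linear map -/

def tens (v : BRing →ₗ[ℂ] BRing) : BRing2 →ₗ[ℂ] BRing2 :=
  (MvPolynomial.basisMonomials (ℕ ⊕ ℕ) ℂ).constr ℂ fun d =>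
    inL (v (monomial (d.comapDomain Sum.inl Sum.inl_injective.injOn) 1)) *
    inR (v (monomial (d.comapDomain Sum.inr Sum.inr_injective.injOn) 1))

def iL : BRing →ₐ[ℂ] BRing2 := MvPolynomial.rename Sum.inl
def iR : BRing →ₐ[ℂ] BRing2 := MvPolynomial.rename Sum.inr

lemma inL_eq (p : BRing) : inL p = iL p := rfl
lemma inR_eq (p : BRing) : inR p = iR p := rfl

lemma tens_monomial (v : BRing →ₗ[ℂ] BRing) (d e : ℕ →₀ ℕ) :
    tens v (iL (monomial d 1) * iR (monomial e 1)) =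
      iL (v (monomial d 1)) * iR (v (monomial e 1)) := by
  have h1 : iL (monomial d 1) * iR (monomial e 1) =
      MvPolynomial.basisMonomials (ℕ ⊕ ℕ) ℂ (d.mapDomain Sum.inl + e.mapDomain Sum.inr) := by
    simp [iL, iR, MvPolynomial.rename_monomial, MvPolynomial.monomial_mul]
  rw [h1, tens, Module.Basis.constr_basis, inL_eq, inR_eq]
  have h2 : (d.mapDomain Sum.inl + e.mapDomain Sum.inr : ℕ ⊕ ℕ →₀ ℕ).comapDomain Sum.inl
      Sum.inl_injective.injOn = d := by
    ext i
    rw [Finsupp.comapDomain_apply, Finsupp.add_apply, Finsupp.mapDomain_apply Sum.inl_injective,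
      Finsupp.mapDomain_notin_range _ _ (by simp), add_zero]
  have h3 : (d.mapDomain Sum.inl + e.mapDomain Sum.inr : ℕ ⊕ ℕ →₀ ℕ).comapDomain Sum.inr
      Sum.inr_injective.injOn = e := by
    ext i
    rw [Finsupp.comapDomain_apply, Finsupp.add_apply, Finsupp.mapDomain_apply Sum.inr_injective,
      Finsupp.mapDomain_notin_range _ _ (by simp), zero_add]
  rw [h2, h3]

lemma tens_apply (v : BRing →ₗ[ℂ] BRing) (p q : BRing) :
    tens v (iL p * iR q) = iL (v p) * iR (v q) := by
  have hm : ∀ (d : ℕ →₀ ℕ) (a : ℂ), (monomial d a : BRing) = a • monomial d 1 := by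
    intro d a; simp [MvPolynomial.smul_monomial]
  induction p using MvPolynomial.induction_on' with
  | monomial d a =>
    induction q using MvPolynomial.induction_on' with
    | monomial e b =>
      rw [hm d a, hm e b]
      simp only [map_smul, smul_mul_assoc, mul_smul_comm, tens_monomial]
    | add p q hp hq => simp only [map_add, mul_add, hp, hq]
  | add p q hp hq => simp only [map_add, add_mul, hp, hq]

/-! ### Conclusion -/

lemma BKP_iff (p : BRing) (N : ℕ) (hN : (shM p).natDegree ≤ N) :
    SatisfiesBKP p ↔ ∑ m ∈ Finset.Icc (-(N : ℤ)) N, ep m • (iL (V m p) * iR (V (-m) p)) =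
      iL p * iR p := by
  unfold SatisfiesBKP
  rw [finsum_eq_sum_of_support_subset (s := Finset.Icc (-(N : ℤ)) N)]
  · have : ∀ m : ℤ, inL (leftCoeff p m) * inR (rightCoeff p (-m)) =
        ep m • (iL (V m p) * iR (V (-m) p)) := by
      intro m
      rw [leftCoeff_eq, rightCoeff_eq, inL_eq, inR_eq, Vr_eq, map_smul, ep_neg, mul_smul_comm]
    simp only [this]
    rfl
  · intro m hm
    rw [Function.mem_support, leftCoeff_eq, rightCoeff_eq, Vr_eq] at hm
    simp only [Finset.coe_Icc, Set.mem_Icc]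
    by_contra hc
    apply hm
    by_cases h1 : m < -(N : ℤ)
    · rw [V_vanish p m (by omega), map_zero, zero_mul]
    · rw [V_vanish p (-m) (by omega), smul_zero, map_zero, mul_zero]

def W (b : ℤ → ℂ) (N : ℕ) : BRing →ₗ[ℂ] BRing := ∑ j ∈ Finset.Icc (-(N : ℤ)) N, b j • V j

lemma W_apply (b : ℤ → ℂ) (N : ℕ) (p : BRing) :
    W b N p = ∑ j ∈ Finset.Icc (-(N : ℤ)) N, b j • V j p := by
  simp [W, LinearMap.sum_apply]

lemma V_W (b : ℤ → ℂ) (N : ℕ) (p : BRing) (m : ℤ) (hm : m ∈ Finset.Icc (-(N : ℤ)) N) :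
    V m (W b N p) = (2 * ep m * b (-m)) • p - W b N (V m p) := by
  rw [eq_sub_iff_add_eq, W_apply, W_apply, map_sum, ← Finset.sum_add_distrib]
  have : ∀ j ∈ Finset.Icc (-(N : ℤ)) N, V m (b j • V j p) + b j • V j (V m p) =
      if j = -m then (2 * ep m * b (-m)) • p else 0 := by
    intro j _
    rw [map_smul, ← smul_add, clifford]
    have h : m + j = 0 ↔ j = -m := by omega
    simp only [h]
    split_ifs with h'
    · rw [h', smul_smul, mul_comm]
    · simp
  rw [Finset.sum_congr rfl this, Finset.sum_ite_eq', if_pos]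
  rw [Finset.mem_Icc] at hm ⊢
  omega

lemma W_W (b : ℤ → ℂ) (N : ℕ) (p : BRing) :
    W b N (W b N p) = (∑ m ∈ Finset.Icc (-(N : ℤ)) N, ep m * b m * b (-m)) • p := by
  have h1 : W b N (W b N p) = ∑ m ∈ Finset.Icc (-(N : ℤ)) N, b m • W b N (V m p) := by
    conv_lhs => rw [W_apply b N p]
    rw [map_sum]
    simp only [map_smul]
  have h2 : W b N (W b N p) = ∑ m ∈ Finset.Icc (-(N : ℤ)) N, b m • V m (W b N p) :=
    W_apply _ _ _
  have h3 : (2 : ℂ) • W b N (W b N p) =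
      (2 : ℂ) • (∑ m ∈ Finset.Icc (-(N : ℤ)) N, ep m * b m * b (-m)) • p := by
    rw [two_smul]
    nth_rw 1 [h1]
    rw [h2, ← Finset.sum_add_distrib, Finset.sum_smul, Finset.smul_sum]
    refine Finset.sum_congr rfl fun m hm => ?_
    rw [V_W b N p m hm]
    module
  exact smul_right_injective _ (two_ne_zero) h3

lemma sum_refl (N : ℕ) {A : Type} [AddCommMonoid A] (f : ℤ → A) :
    ∑ m ∈ Finset.Icc (-(N : ℤ)) N, f (-m) = ∑ m ∈ Finset.Icc (-(N : ℤ)) N, f m := by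
  apply Finset.sum_nbij' (fun m => -m) (fun m => -m)
  · intro m; simp only [Finset.mem_Icc]; omega
  · intro m; simp only [Finset.mem_Icc]; omega
  · simp
  · simp
  · simp

lemma main (τ : BRing) (b : ℤ → ℂ) (N : ℕ)
    (h : ∑ m ∈ Finset.Icc (-(N : ℤ)) N, ep m • (iL (V m τ) * iR (V (-m) τ)) =
      iL τ * iR τ) :
    ∑ m ∈ Finset.Icc (-(N : ℤ)) N, ep m • (iL (V m (W b N τ)) * iR (V (-m) (W b N τ))) =
      iL (W b N τ) * iR (W b N τ) := by
  set c : ℂ := ∑ m ∈ Finset.Icc (-(N : ℤ)) N, ep m * b m * b (-m) with hc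
  have h1 := congrArg (tens (W b N)) h
  rw [map_sum, tens_apply] at h1
  simp only [map_smul, tens_apply] at h1
  have hWW : ∑ m ∈ Finset.Icc (-(N : ℤ)) N, b m • W b N (V m τ) = c • τ := by
    rw [hc, ← W_W, W_apply b N τ, map_sum]
    simp only [map_smul]
  have step : ∀ m ∈ Finset.Icc (-(N : ℤ)) N,
      ep m • (iL (V m (W b N τ)) * iR (V (-m) (W b N τ))) =
      ep m • (iL (W b N (V m τ)) * iR (W b N (V (-m) τ)))
      + (4 * (ep m * b m * b (-m))) • (iL τ * iR τ)
      - (2 : ℂ) • (iL τ * iR (b (-m) • W b N (V (-m) τ)))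
      - (2 : ℂ) • (iL (b m • W b N (V m τ)) * iR τ) := by
    intro m hm
    have hm' : -m ∈ Finset.Icc (-(N : ℤ)) N := by
      rw [Finset.mem_Icc] at hm ⊢
      omega
    rw [V_W b N τ m hm, V_W b N τ (-m) hm', neg_neg, ep_neg]
    have he := ep_sq m
    simp only [map_sub, map_smul, sub_mul, mul_sub, smul_mul_assoc, mul_smul_comm, smul_sub,
      smul_smul]
    have e1 : ep m * (2 * ep m * b m * (2 * ep m * b (-m))) = 4 * (ep m * b m * b (-m)) := by
      linear_combination (4 * ep m * b m * b (-m)) * he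
    have e1' : ep m * (2 * ep m * b (-m) * (2 * ep m * b m)) = 4 * (ep m * b m * b (-m)) := by
      linear_combination (4 * ep m * b m * b (-m)) * he
    have e2 : ∀ x, ep m * (2 * ep m * x) = 2 * x := by
      intro x
      linear_combination (2 * x) * he
    simp only [e1, e1', e2]
    abel
  rw [Finset.sum_congr rfl step, Finset.sum_sub_distrib, Finset.sum_sub_distrib,
    Finset.sum_add_distrib, h1, ← Finset.sum_smul, ← Finset.mul_sum, ← hc,
    ← Finset.smul_sum, ← Finset.smul_sum, ← Finset.mul_sum, ← Finset.sum_mul, ← map_sum, ← map_sum,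
    sum_refl N (fun m => b m • W b N (V m τ)), hWW]
  simp only [map_smul, smul_mul_assoc, mul_smul_comm]
  module

lemma vOp_eq (a : ℤ → ℂ) (τ : BRing) (N : ℕ) (hN : (shM τ).natDegree ≤ N)
    (ha : ∀ j < -(N : ℤ), a j = 0) : vOp a τ = W (fun j => a (-j) * sqrt2⁻¹) N τ := by
  unfold vOp
  rw [finsum_eq_sum_of_support_subset (s := Finset.Icc (-(N : ℤ)) N), W_apply,
    ← sum_refl N]
  · simp only [phiHat_eq, neg_neg, smul_smul]
  · intro m hm
    rw [Function.mem_support, phiHat_eq] at hm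
    simp only [Finset.coe_Icc, Set.mem_Icc]
    by_contra hc
    apply hm
    by_cases h1 : m < -(N : ℤ)
    · rw [ha m h1, zero_smul]
    · rw [V_vanish τ (-m) (by omega), smul_zero, smul_zero]

end

end BKPProof

noncomputable section

/-- Let `τ ∈ B = ℂ[t₁,t₃,t₅,…]` be a nonzero polynomial satisfying the
BKP bilinear identity, and let `v = ∑_{j∈ℤ} a_j φ̂_j` be an operator on `B` with complex
coefficients vanishing for all sufficiently negative `j`.  Then `v τ` is either zero or
again satisfies the BKP bilinear identity. -/
theorem vOp_preserves_BKP (τ : BRing) (hτ : τ ≠ 0) (h : SatisfiesBKP τ)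
    (a : ℤ → ℂ) (ha : BddBelowSupport a) :
    vOp a τ = 0 ∨ SatisfiesBKP (vOp a τ) := by
  right
  obtain ⟨K, hK⟩ := ha
  set N : ℕ := K.natAbs + (BKPProof.shM τ).natDegree + (BKPProof.shM (vOp a τ)).natDegree with hN
  rw [BKPProof.BKP_iff _ N (by omega)]
  rw [BKPProof.BKP_iff _ N (by omega)] at h
  rw [BKPProof.vOp_eq a τ N (by omega) (fun j hj => hK j (by omega))]
  exact BKPProof.main τ _ N h

end
end
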